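/- arXiv:2104.13789 — 2 statements merged into one kernel-verified Lean document; each statement's English description precedes it below -/
import Mathlib

section
/- Divergence of the change-point test statistic under the alternative (Theorem 2 of the paper, with the consequences of assumptions (A1)–(A4) made explicit): Fix τ* ∈ (0,1) and θ₁*, θ₂* ∈ ℝ^d with θ₁* ≠ θ₂*, and for each n set t*_n = ⌊τ* n⌋. Suppose that for each n, θ̂(T_{1,t*_n}) and θ̂(T_{t*_n+1,n}) are ℝ^d-valued random vectors with θ̂(T_{1,t*_n}) → θ₁* in probability and θ̂(T_{t*_n+1,n}) → θ₂* in probability, and that Ω̂_n = (1/2)(Â_n + B̂_n), where Â_n and B̂_n are random symmetric positive semidefinite d×d matrices with Â_n → A almost surely for a (deterministic) symmetric positive definite matrix A. Define Q̂_{n,t*_n} = ((t*_n (n − t*_n))² / n³) · (θ̂(T_{1,t*_n}) − θ̂(T_{t*_n+1,n}))ᵀ Ω̂_n (θ̂(T_{1,t*_n}) − θ̂(T_{t*_n+1,n})). Then Q̂_{n,t*_n} → +∞ in probability, i.e. for every M > 0, P(Q̂_{n,t*_n} > M) → 1 as n → ∞; consequently any statistic Q̂_n with Q̂_n ≥ Q̂_{n,t*_n}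 for all large n (in particular Q̂_n = max_{k∈𝒯_n} Q̂_{n,k} once t*_n ∈ 𝒯_n) tends to +∞ in probability. -/
/-!
Theorem 2.2 of Diop & Kengne: divergence of the change-point test statistic
under the alternative hypothesis (with the consequences of (A1)–(A4) made
explicit as hypotheses).
-/

open MeasureTheory Filter Finset Topology Matrix

noncomputable section

namespace ChangePointDivergence

/-- ℓ¹ norm on `ℝ^d`. -/
def l1 {d : ℕ} (x : Fin d → ℝ) : ℝ := ∑ i, |x i|

/-- Convergence in probability (w.r.t. the ℓ¹ norm). -/
def TendstoInProb {Ω : Type*} [MeasurableSpace Ω] (μ : Measure Ω) {d : ℕ}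
    (X : ℕ → Ω → Fin d → ℝ) (x : Fin d → ℝ) : Prop :=
  ∀ ε > (0 : ℝ), Tendsto (fun n => μ {ω | ε ≤ l1 (fun i => X n ω i - x i)}) atTop (𝓝 0)

/-- A real symmetric matrix is positive semidefinite. -/
def IsSymmPSD {d : ℕ} (M : Matrix (Fin d) (Fin d) ℝ) : Prop :=
  M.IsSymm ∧ ∀ v : Fin d → ℝ, 0 ≤ v ⬝ᵥ M.mulVec v

/-- The scaling factor of the statistic at the break point diverges. -/
theorem tendsto_scaling_atTop {τ : ℝ} (hτ0 : 0 < τ) (hτ1 : τ < 1) :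
    Tendsto (fun n : ℕ =>
      ((⌊τ * n⌋₊ : ℝ) * ((n : ℝ) - (⌊τ * n⌋₊ : ℝ))) ^ 2 / (n : ℝ) ^ 3) atTop atTop := by
  have hfloor : Tendsto (fun n : ℕ => (⌊τ * n⌋₊ : ℝ) / (n : ℝ)) atTop (𝓝 τ) :=
    (tendsto_nat_floor_mul_div_atTop hτ0.le).comp tendsto_natCast_atTop_atTop
  have hlim : Tendsto (fun n : ℕ => ((⌊τ * n⌋₊ : ℝ) / (n : ℝ) *
      (1 - (⌊τ * n⌋₊ : ℝ) / (n : ℝ))) ^ 2) atTop (𝓝 ((τ * (1 - τ)) ^ 2)) :=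
    (hfloor.mul (tendsto_const_nhds.sub hfloor)).pow 2
  have hpos : 0 < (τ * (1 - τ)) ^ 2 := pow_pos (mul_pos hτ0 (sub_pos.2 hτ1)) 2
  refine (Tendsto.atTop_mul_pos hpos tendsto_natCast_atTop_atTop hlim).congr' ?_
  filter_upwards [eventually_gt_atTop 0] with n hn
  have hn0 : (n : ℝ) ≠ 0 := by exact_mod_cast hn.ne'
  field_simp

/-- If almost every point lies eventually in a sequence of (not necessarily measurable) events
and the exceptional sets `E n` have vanishing outer measure, then the outer measures
of any sets containing the good parts tend to one. -/
theorem tendsto_measure_one_of_ae_eventually {Ω : Type*} [MeasurableSpace Ω] {μ : Measure Ω}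
    [IsProbabilityMeasure μ] {p : ℕ → Ω → Prop} (hp : ∀ᵐ ω ∂μ, ∀ᶠ n in atTop, p n ω)
    {E S : ℕ → Set Ω} (hE : Tendsto (fun n => μ (E n)) atTop (𝓝 0))
    (hS : ∀ᶠ n in atTop, ∀ ω, p n ω → ω ∉ E n → ω ∈ S n) :
    Tendsto (fun n => μ (S n)) atTop (𝓝 1) := by
  let G : ℕ → Set Ω := fun N => {ω | ∀ n ≥ N, p n ω}
  have hmono : Monotone G := fun a b hab ω hω n hn => hω n (hab.trans hn)
  have hG : Tendsto (fun n => μ (G n)) atTop (𝓝 1) := by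
    have hunion : μ (⋃ n, G n) = 1 := by
      have hae : (⋃ n, G n : Set Ω) =ᵐ[μ] Set.univ := by
        refine eventuallyEq_univ.2 ?_
        filter_upwards [hp] with ω hω
        obtain ⟨N, hN⟩ := eventually_atTop.1 hω
        exact Set.mem_iUnion.2 ⟨N, hN⟩
      rw [measure_congr hae, measure_univ]
    exact hunion ▸ tendsto_measure_iUnion_atTop hmono
  have hsub : Tendsto (fun n => μ (G n) - μ (E n)) atTop (𝓝 1) := by
    simpa using ENNReal.Tendsto.sub hG hE (Or.inl ENNReal.one_ne_top)
  refine tendsto_of_tendsto_of_tendsto_of_le_of_le' hsub tendsto_const_nhds ?_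
    (Eventually.of_forall fun n => prob_le_one)
  filter_upwards [hS] with n hn
  refine tsub_le_iff_right.2 ((measure_mono ?_).trans (measure_union_le (S n) (E n)))
  intro ω hω
  by_cases hωE : ω ∈ E n
  · exact Or.inr hωE
  · exact Or.inl (hn ω (hω n le_rfl) hωE)

/-- Vectors that are close in `ℓ¹` are close in the sup distance. -/
theorem dist_le_l1 {d : ℕ} (x y : Fin d → ℝ) : dist x y ≤ l1 (fun i => x i - y i) := by
  have hnonneg : 0 ≤ l1 (fun i => x i - y i) := Finset.sum_nonneg fun i _ => abs_nonneg _
  refine (dist_pi_le_iff hnonneg).2 fun i => ?_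
  exact Finset.single_le_sum (f := fun i => |x i - y i|) (fun j _ => abs_nonneg _)
    (Finset.mem_univ i)

/-- A quadratic form that is positive at `v` is bounded below by a positive constant near `v`,
uniformly over nearby matrices. -/
theorem exists_quadratic_form_lower_bound {d : ℕ} {A : Matrix (Fin d) (Fin d) ℝ} (hA : A.PosDef)
    {v : Fin d → ℝ} (hv : v ≠ 0) :
    ∃ c > (0 : ℝ), ∃ U ∈ 𝓝 A, ∃ ε > (0 : ℝ), ∀ B ∈ U, ∀ w, dist w v < ε →
      c < w ⬝ᵥ B.mulVec w := by
  have hpos : 0 < v ⬝ᵥ A.mulVec v := by simpa using hA.dotProduct_mulVec_pos hv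
  have hcont : Continuous fun p : Matrix (Fin d) (Fin d) ℝ × (Fin d → ℝ) =>
      p.2 ⬝ᵥ p.1.mulVec p.2 :=
    continuous_snd.dotProduct (continuous_fst.matrix_mulVec continuous_snd)
  have hev := hcont.continuousAt (x := (A, v)) |>.eventually (lt_mem_nhds (half_lt_self hpos))
  obtain ⟨U, hU, V, hV, hUV⟩ := mem_nhds_prod_iff.1 hev
  obtain ⟨ε, hε, hεV⟩ := Metric.mem_nhds_iff.1 hV
  exact ⟨_, half_pos hpos, U, hU, ε, hε, fun B hB w hw =>
    hUV (Set.mk_mem_prod hB (hεV (Metric.mem_ball.2 hw)))⟩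

theorem test_statistic_diverges_under_alternative
    {d : ℕ} {Ω : Type*} [MeasurableSpace Ω] (μ : Measure Ω) [IsProbabilityMeasure μ]
    (τ : ℝ) (hτ0 : 0 < τ) (hτ1 : τ < 1)
    (θ1 θ2 : Fin d → ℝ) (hθ : θ1 ≠ θ2)
    -- t*_n = ⌊τ n⌋
    (tstar : ℕ → ℕ) (htstar : ∀ n, tstar n = ⌊τ * n⌋₊)
    -- the estimators on the two segments
    (θhat1 θhat2 : ℕ → Ω → Fin d → ℝ)
    (hθhat1 : TendstoInProb μ θhat1 θ1)
    (hθhat2 : TendstoInProb μ θhat2 θ2)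
    -- Ω̂_n = (1/2)(Â_n + B̂_n)
    (Ahat Bhat : ℕ → Ω → Matrix (Fin d) (Fin d) ℝ)
    (hAhatPSD : ∀ n ω, IsSymmPSD (Ahat n ω))
    (hBhatPSD : ∀ n ω, IsSymmPSD (Bhat n ω))
    (A : Matrix (Fin d) (Fin d) ℝ) (hA : A.PosDef)
    (hAhatA : ∀ᵐ ω ∂μ, Tendsto (fun n => Ahat n ω) atTop (𝓝 A))
    -- the test statistic at the break point
    (Qhat : ℕ → Ω → ℝ)
    (hQhat : ∀ n ω, Qhat n ω =
      ((tstar n : ℝ) * ((n : ℝ) - tstar n)) ^ 2 / (n : ℝ) ^ 3 *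
        ((fun i => θhat1 n ω i - θhat2 n ω i) ⬝ᵥ
          ((1 / 2 : ℝ) • (Ahat n ω + Bhat n ω)).mulVec
            fun i => θhat1 n ω i - θhat2 n ω i)) :
    -- Q̂_{n,t*_n} → +∞ in probability
    (∀ M > (0 : ℝ), Tendsto (fun n => μ {ω | M < Qhat n ω}) atTop (𝓝 1)) ∧
    -- consequently, any statistic eventually dominating Q̂_{n,t*_n} (in
    -- particular Q̂_n = max_{k∈𝒯_n} Q̂_{n,k}) also tends to +∞ in probability
    (∀ Qn : ℕ → Ω → ℝ, (∀ᶠ n in atTop, ∀ ω, Qhat n ω ≤ Qn n ω) →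
      ∀ M > (0 : ℝ), Tendsto (fun n => μ {ω | M < Qn n ω}) atTop (𝓝 1)) := by
  have main : ∀ Qn : ℕ → Ω → ℝ, (∀ᶠ n in atTop, ∀ ω, Qhat n ω ≤ Qn n ω) →
      ∀ M > (0 : ℝ), Tendsto (fun n => μ {ω | M < Qn n ω}) atTop (𝓝 1) := by
    intro Qn hQn M _
    obtain ⟨c, hc, U, hU, ε, hε, hlow⟩ :=
      exists_quadratic_form_lower_bound hA (sub_ne_zero.2 hθ)
    have hE : Tendsto (fun n => μ ({ω | ε / 2 ≤ l1 (fun i => θhat1 n ω i - θ1 i)} ∪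
        {ω | ε / 2 ≤ l1 (fun i => θhat2 n ω i - θ2 i)})) atTop (𝓝 0) := by
      refine tendsto_of_tendsto_of_tendsto_of_le_of_le tendsto_const_nhds ?_
        (fun n => zero_le) (fun n => measure_union_le _ _)
      simpa using (hθhat1 _ (half_pos hε)).add (hθhat2 _ (half_pos hε))
    refine tendsto_measure_one_of_ae_eventually (p := fun n ω => Ahat n ω ∈ U)
      (hAhatA.mono fun ω hω => hω.eventually hU) hE ?_
    filter_upwards [hQn, (tendsto_scaling_atTop hτ0 hτ1).eventually_gt_atTop (M / (c / 2)),
      (tendsto_scaling_atTop hτ0 hτ1).eventually_ge_atTop 0] with n hn hM h0 ω hωU hωE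
    simp only [Set.mem_union, Set.mem_ofPred_eq, not_or, not_le] at hωE ⊢
    refine lt_of_lt_of_le ?_ (hn ω)
    have hdist : dist (θhat1 n ω - θhat2 n ω) (θ1 - θ2) < ε := by
      have h := dist_sub_sub_le (θhat1 n ω) (θhat2 n ω) θ1 θ2
      have h1 := dist_le_l1 (θhat1 n ω) θ1
      have h2 := dist_le_l1 (θhat2 n ω) θ2
      linarith [hωE.1, hωE.2]
    have hAlow := hlow _ hωU _ hdist
    have hBlow := (hBhatPSD n ω).2 (θhat1 n ω - θhat2 n ω)
    have hquad : c / 2 ≤ (θhat1 n ω - θhat2 n ω) ⬝ᵥ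
        ((1 / 2 : ℝ) • (Ahat n ω + Bhat n ω)).mulVec (θhat1 n ω - θhat2 n ω) := by
      rw [Matrix.smul_mulVec, Matrix.add_mulVec, dotProduct_smul, dotProduct_add, smul_eq_mul]
      linarith
    rw [hQhat, htstar]
    exact ((div_lt_iff₀ (half_pos hc)).1 hM).trans_le (mul_le_mul_of_nonneg_left hquad h0)
  exact ⟨main Qhat (Eventually.of_forall fun n ω => le_rfl), main⟩

end ChangePointDivergence
end
end

section
/- Proposition 4.1 (existence of a stationary ergodic solution for multivariate count models with m-parameter exponential family conditional distribution; the paper additionally asserts τ-weak dependence, which is omitted here): Let p(y|η) = exp{ηᵀy − A(η)} h(y), y ∈ ℕ₀^m, be an m-parameter exponential family of probability distributions on ℕ₀^m, where A is twice continuously differentiable on the natural parameter space, so that the mean of p(·|η) is ∂A(η)/∂η. Let f_θ : (ℕ₀^m)^∞ → [0,∞)^m satisfy Assumption A₀(Θ) at the given θ: ‖f_θ(0)‖ < ∞ and there exist nonnegative reals (α_k^{(0)})_{k≥1} with Σ_k α_k^{(0)} < 1 such that ‖f_θ(y) − f_θ(y')‖ ≤ Σ_k α_k^{(0)} ‖y_k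 − y'_k‖ for all y, y' ∈ (ℕ₀^m)^∞, and assume every value of f_θ lies in the range of η ↦ ∂A(η)/∂η. Then there exists a strictly stationary and ergodic process (Y_t)_{t∈ℤ} with values in ℕ₀^m, satisfying E‖Y_t‖ < ∞, such that for every t the conditional distribution of Y_t given F_{t-1} = σ(Y_{t-1}, Y_{t-2}, …) is p(·|η_t), where η_t is determined by ∂A(η_t)/∂η = f_θ(Y_{t-1}, Y_{t-2}, …); in particular E(Y_t | F_{t-1}) = f_θ(Y_{t-1}, Y_{t-2}, …). -/
/-!
Proposition 4.1 of Diop & Kengne: existence of a strictly stationary and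
ergodic solution of the multivariate count model whose conditional distribution
belongs to the m-parameter exponential family (the τ-weak dependence assertion
of the paper is omitted).
-/

open MeasureTheory Filter Finset Topology

noncomputable section

namespace ChangePointProp41

/-- ℓ¹ norm of an `ℕ^m`-valued vector. -/
def l1n {m : ℕ} (x : Fin m → ℕ) : ℝ := ∑ i, (x i : ℝ)

/-- ℓ¹ distance between two `ℕ^m`-valued vectors. -/
def l1dist {m : ℕ} (x y : Fin m → ℕ) : ℝ := ∑ i, |(x i : ℝ) - (y i : ℝ)|

/-- ℓ¹ norm on `ℝ^m`. -/
def l1 {m : ℕ} (x : Fin m → ℝ) : ℝ := ∑ i, |x i|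

/-- The shift on two-sided path space. -/
def shift {α : Type*} (x : ℤ → α) : ℤ → α := fun t => x (t + 1)

/-- The infinite past `(Y_{t-1}, Y_{t-2}, …)` at time `t`. -/
def past {m : ℕ} {Ω : Type*} (Y : ℤ → Ω → Fin m → ℕ) (t : ℤ) (ω : Ω) :
    ℕ → Fin m → ℕ := fun k => Y (t - 1 - k) ω

/-- σ-algebra generated by `Y_s`, `s ≤ t`. -/
def filt {m : ℕ} {Ω : Type*} (Y : ℤ → Ω → Fin m → ℕ) (t : ℤ) : MeasurableSpace Ω :=
  ⨆ s : {s : ℤ // s ≤ t}, MeasurableSpace.comap (Y s.1) inferInstance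

/-- The m-parameter exponential family density `p(y|η) = exp(ηᵀy − A(η)) h(y)`. -/
def expFam {m : ℕ} (A : (Fin m → ℝ) → ℝ) (h : (Fin m → ℕ) → ℝ)
    (y : Fin m → ℕ) (η : Fin m → ℝ) : ℝ :=
  Real.exp ((∑ i, η i * (y i : ℝ)) - A η) * h y

/-- Gradient (within the natural parameter space `N`) of the log-partition
function `A`. -/
def gradA {m : ℕ} (A : (Fin m → ℝ) → ℝ) (N : Set (Fin m → ℝ))
    (η : Fin m → ℝ) (i : Fin m) : ℝ :=
  fderivWithin ℝ A N η (Pi.single i 1)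

section ExponentialFamily

lemma sq_div_le_mul_exp_sub_one (x : ℝ) : x ^ 2 ≤ (1 + |x|) * (x * (Real.exp x - 1)) := by
  rcases le_total 0 x with hx | hx
  · rw [abs_of_nonneg hx]
    have h1 := Real.add_one_le_exp x
    nlinarith [mul_nonneg hx (sub_nonneg.2 h1), mul_nonneg hx (mul_nonneg hx (sub_nonneg.2 h1)),
      pow_nonneg hx 3]
  · rw [abs_of_nonpos hx]
    have h1 := Real.add_one_le_exp (-x)
    have h2 : Real.exp x * Real.exp (-x) = 1 := by rw [← Real.exp_add]; simp
    have h3 : Real.exp x * (1 - x) ≤ 1 := by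
      nlinarith [mul_le_mul_of_nonneg_left h1 (Real.exp_pos x).le]
    nlinarith [mul_nonneg (neg_nonneg.2 hx) (sub_nonneg.2 h3)]

variable {m : ℕ}

/-- The count vector `y` with an additional coordinate equal to one. -/
def augment (y : Fin m → ℕ) : (Fin m → ℝ) × ℝ := (fun i => (y i : ℝ), 1)

/-- The linear form whose value at `augment y` is the exponent `ηᵀy − A(η)`. -/
def exponentForm (A : (Fin m → ℝ) → ℝ) (η : Fin m → ℝ) : (Fin m → ℝ) × ℝ →ₗ[ℝ] ℝ where
  toFun v := (∑ i, η i * v.1 i) - A η * v.2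
  map_add' v w := by simp [mul_add, Finset.sum_add_distrib]; ring
  map_smul' c v := by
    simp only [Prod.smul_fst, Pi.smul_apply, smul_eq_mul, Prod.smul_snd, RingHom.id_apply,
      mul_sub, Finset.mul_sum]
    congr 1
    · exact Finset.sum_congr rfl fun i _ => by ring
    · ring

lemma expFam_eq (A : (Fin m → ℝ) → ℝ) (h : (Fin m → ℕ) → ℝ) (y : Fin m → ℕ) (η : Fin m → ℝ) :
    expFam A h y η = Real.exp (exponentForm A η (augment y)) * h y := by
  simp [expFam, exponentForm, augment]

lemma hasSum_expFam_smul_augment {A : (Fin m → ℝ) → ℝ} {h : (Fin m → ℕ) → ℝ}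
    {η lam : Fin m → ℝ} (h1 : HasSum (fun y : Fin m → ℕ => expFam A h y η) 1)
    (h2 : ∀ i, HasSum (fun y : Fin m → ℕ => (y i : ℝ) * expFam A h y η) (lam i)) :
    HasSum (fun y : Fin m → ℕ => expFam A h y η • augment y) (lam, (1 : ℝ)) := by
  refine HasSum.prodMk (f := fun y : Fin m → ℕ => (expFam A h y η • augment y).1)
    (g := fun y : Fin m → ℕ => (expFam A h y η • augment y).2) (Pi.hasSum.2 fun i => ?_) ?_
  · simpa [augment, mul_comm] using h2 i
  · simpa [augment] using h1

/-- The symmetrized Kullback–Leibler divergence of two members of an exponential family dominates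
each of its terms. -/
lemma mul_exp_sub_one_le {A : (Fin m → ℝ) → ℝ} {h : (Fin m → ℕ) → ℝ} (hh : ∀ y, 0 ≤ h y)
    {η η' lam lam' : Fin m → ℝ} (h1 : HasSum (fun y : Fin m → ℕ => expFam A h y η) 1)
    (h2 : ∀ i, HasSum (fun y : Fin m → ℕ => (y i : ℝ) * expFam A h y η) (lam i))
    (h1' : HasSum (fun y : Fin m → ℕ => expFam A h y η') 1)
    (h2' : ∀ i, HasSum (fun y : Fin m → ℕ => (y i : ℝ) * expFam A h y η') (lam' i))
    (y : Fin m → ℕ) :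
    expFam A h y η * ((exponentForm A η' - exponentForm A η) (augment y) *
      (Real.exp ((exponentForm A η' - exponentForm A η) (augment y)) - 1)) ≤
      (exponentForm A η' - exponentForm A η) ((lam', (1 : ℝ)) - (lam, (1 : ℝ))) := by
  set ω := exponentForm A η' - exponentForm A η with hω
  have hs := ((hasSum_expFam_smul_augment h1' h2').sub (hasSum_expFam_smul_augment h1 h2)).mapL
    (LinearMap.toContinuousLinearMap ω)
  have hterm : ∀ z, LinearMap.toContinuousLinearMap ω
      (expFam A h z η' • augment z - expFam A h z η • augment z) =
      expFam A h z η * (ω (augment z) * (Real.exp (ω (augment z)) - 1)) := by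
    intro z
    have : Real.exp (exponentForm A η' (augment z)) =
        Real.exp (exponentForm A η (augment z)) * Real.exp (ω (augment z)) := by
      rw [← Real.exp_add, hω]; simp
    rw [← sub_smul]
    simp only [LinearMap.coe_toContinuousLinearMap', map_smul, smul_eq_mul, expFam_eq, this]
    ring
  simp only [hterm] at hs
  refine le_hasSum hs y fun z _ => mul_nonneg ?_ ?_
  · rw [expFam_eq]; exact mul_nonneg (Real.exp_pos _).le (hh z)
  · exact (pow_two_nonneg _).trans (sq_div_le_mul_exp_sub_one (ω (augment z))) |>
      (nonneg_of_mul_nonneg_right · (by positivity))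

/-- In an exponential family, convergence of the means implies convergence of the densities. -/
lemma tendsto_expFam {ι : Type*} {l : Filter ι} {A : (Fin m → ℝ) → ℝ} {h : (Fin m → ℕ) → ℝ}
    (hh : ∀ y, 0 ≤ h y) {η lam : Fin m → ℝ} {η' lam' : ι → Fin m → ℝ}
    (h1 : HasSum (fun y : Fin m → ℕ => expFam A h y η) 1)
    (h2 : ∀ i, HasSum (fun y : Fin m → ℕ => (y i : ℝ) * expFam A h y η) (lam i))
    (h1' : ∀ n, HasSum (fun y : Fin m → ℕ => expFam A h y (η' n)) 1)
    (h2' : ∀ n i, HasSum (fun y : Fin m → ℕ => (y i : ℝ) * expFam A h y (η' n)) (lam' n i))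
    (hlim : Tendsto lam' l (𝓝 lam)) (y : Fin m → ℕ) :
    Tendsto (fun n => expFam A h y (η' n)) l (𝓝 (expFam A h y η)) := by
  by_cases hy : h y = 0
  · simpa [expFam, hy] using tendsto_const_nhds
  obtain ⟨b, hbS, hspan, hli⟩ := exists_linearIndependent ℝ (augment '' {z | h z ≠ 0})
  set W := Submodule.span ℝ b with hW
  have hmem : ∀ z, h z ≠ 0 → augment z ∈ W := fun z hz => by
    rw [hspan]; exact Submodule.subset_span ⟨z, hz, rfl⟩
  have : Fintype b := hli.setFinite.fintype
  let B : Module.Basis b ℝ W :=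
    (Module.Basis.span hli).map (LinearEquiv.ofEq _ _ (by rw [hW]; simp))
  have hB : ∀ i, (B i : (Fin m → ℝ) × ℝ) = i := fun i => by
    simp [B, Module.Basis.span_apply]
  have hmean : ∀ {η lam : Fin m → ℝ}, HasSum (fun y : Fin m → ℕ => expFam A h y η) 1 →
      (∀ i, HasSum (fun y : Fin m → ℕ => (y i : ℝ) * expFam A h y η) (lam i)) →
      (lam, (1 : ℝ)) ∈ W := fun {η lam} h1 h2 => by
    refine W.closed_of_finiteDimensional.mem_of_tendsto (hasSum_expFam_smul_augment h1 h2)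
      (Eventually.of_forall fun s => Submodule.sum_mem _ fun z _ => ?_)
    by_cases hz : h z = 0
    · simp [expFam, hz]
    · exact W.smul_mem _ (hmem z hz)
  have hexp : ∀ (ω : (Fin m → ℝ) × ℝ →ₗ[ℝ] ℝ) (w : W),
      ω w = ∑ i, B.repr w i * ω i := fun ω w => by
    have := congrArg (fun v : W => ω v) (B.sum_repr w)
    simp only [map_sum, Submodule.coe_sum, Submodule.coe_smul, map_smul, hB, smul_eq_mul] at this
    exact this.symm
  let w : W := ⟨(lam, 1), hmean h1 h2⟩
  let w' : ι → W := fun n => ⟨(lam' n, 1), hmean (h1' n) (h2' n)⟩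
  have hw : Tendsto (fun n => w' n - w) l (𝓝 0) := by
    rw [← sub_self w]
    refine Tendsto.sub ?_ tendsto_const_nhds
    rw [tendsto_subtype_rng]
    exact hlim.prodMk_nhds tendsto_const_nhds
  have hε : Tendsto (fun n => ∑ i, |B.repr (w' n - w) i|) l (𝓝 0) := by
    have hc : Continuous fun v : W => ∑ i, |B.repr v i| :=
      continuous_finsetSum _ fun i _ =>
        (LinearMap.continuous_of_finiteDimensional (B.coord i)).abs
    have := (hc.tendsto 0).comp hw
    simp only [map_zero, Finsupp.coe_zero, Pi.zero_apply, abs_zero, Finset.sum_const_zero] at this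
    exact this
  let ω : ι → (Fin m → ℝ) × ℝ →ₗ[ℝ] ℝ := fun n => exponentForm A (η' n) - exponentForm A η
  let x : ι → b → ℝ := fun n i => ω n i
  have hx : Tendsto x l (𝓝 0) := by
    rcases isEmpty_or_nonempty b with hb | hb
    · exact tendsto_pi_nhds.2 fun i => isEmptyElim i
    choose z hz hzb using fun i : b => hbS i.2
    obtain ⟨j, hj⟩ := Finite.exists_min fun i => expFam A h (z i) η
    set c := expFam A h (z j) η with hc
    have hcpos : 0 < c := by
      rw [hc, expFam_eq]
      exact mul_pos (Real.exp_pos _) ((hh _).lt_of_ne' (hz j))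
    rw [tendsto_zero_iff_norm_tendsto_zero]
    have hbound : ∀ᶠ n in l, ‖x n‖ ≤ 2 / c * ∑ i, |B.repr (w' n - w) i| := by
      filter_upwards [hε.eventually (ge_mem_nhds (half_pos hcpos))] with n hn
      set ε := ∑ i, |B.repr (w' n - w) i|
      obtain ⟨k, hk⟩ := Finite.exists_max fun i => |x n i|
      have hM : ‖x n‖ = |x n k| :=
        le_antisymm ((pi_norm_le_iff_of_nonneg (abs_nonneg _)).2 hk) (norm_le_pi_norm (x n) k)
      have hterm := mul_exp_sub_one_le hh h1 h2 (h1' n) (h2' n) (z k)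
      have hzk : ω n (augment (z k)) = x n k := by rw [hzb k]
      have hupper : ω n ((lam' n, (1 : ℝ)) - (lam, (1 : ℝ))) ≤ ε * |x n k| := by
        calc ω n ((lam' n, (1 : ℝ)) - (lam, (1 : ℝ))) = ω n (w' n - w : W) := rfl
          _ = ∑ i, B.repr (w' n - w) i * x n i := hexp _ _
          _ ≤ ∑ i, |B.repr (w' n - w) i| * |x n k| := by
            refine Finset.sum_le_sum fun i _ => (le_abs_self _).trans ?_
            rw [abs_mul]
            exact mul_le_mul_of_nonneg_left (hk i) (abs_nonneg _)
          _ = ε * |x n k| := by rw [Finset.sum_mul]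
      change expFam A h (z k) η * (ω n (augment (z k)) *
        (Real.exp (ω n (augment (z k))) - 1)) ≤ ω n _ at hterm
      rw [hzk] at hterm
      have hsq := sq_div_le_mul_exp_sub_one (x n k)
      rw [hM]
      set t := |x n k| with ht
      have ht0 : 0 ≤ t := abs_nonneg _
      have hsq' : t ^ 2 ≤ (1 + t) * (x n k * (Real.exp (x n k) - 1)) := by rwa [ht, sq_abs]
      have hψ : 0 ≤ x n k * (Real.exp (x n k) - 1) :=
        nonneg_of_mul_nonneg_right ((sq_nonneg t).trans hsq') (by positivity)
      have h3 : c * (x n k * (Real.exp (x n k) - 1)) ≤ ε * t :=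
        (mul_le_mul_of_nonneg_right (hj k) hψ).trans (hterm.trans hupper)
      have h4 : c * t ^ 2 ≤ (1 + t) * (ε * t) := by
        nlinarith [mul_le_mul_of_nonneg_left hsq' hcpos.le,
          mul_le_mul_of_nonneg_left h3 (by positivity : 0 ≤ 1 + t)]
      rcases ht0.eq_or_lt with h0 | h0
      · rw [← h0]; positivity
      · have h5 : c * t ≤ (1 + t) * ε := by
          refine le_of_mul_le_mul_right ?_ h0
          linarith [h4]
        rw [div_mul_eq_mul_div, le_div_iff₀ hcpos]
        nlinarith
    exact squeeze_zero' (Eventually.of_forall fun n => norm_nonneg _) hbound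
      (by simpa using hε.const_mul (2 / c))
  have hωy : Tendsto (fun n => ω n (augment y)) l (𝓝 0) := by
    have : ∀ n, ω n (augment y) = ∑ i, B.repr ⟨augment y, hmem y hy⟩ i * x n i := fun n =>
      hexp (ω n) ⟨augment y, hmem y hy⟩
    simp only [this]
    have h0 : ∀ i, Tendsto (fun n => x n i) l (𝓝 0) := fun i => tendsto_pi_nhds.1 hx i
    simpa using tendsto_finsetSum univ fun i _ =>
      (h0 i).const_mul (B.repr ⟨augment y, hmem y hy⟩ i)
  have hfin : ∀ n, expFam A h y (η' n) = Real.exp (ω n (augment y)) * expFam A h y η := fun n => by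
    rw [expFam_eq, expFam_eq, ← mul_assoc, ← Real.exp_add]; simp [ω]
  simp only [hfin]
  simpa using ((Real.continuous_exp.tendsto 0).comp hωy).mul_const (expFam A h y η)

end ExponentialFamily
section Model

/-- The ℓ¹ norm of a count vector as an extended nonnegative real. -/
def size {m : ℕ} (y : Fin m → ℕ) : ENNReal := ∑ i, (y i : ENNReal)

lemma ofReal_l1n {m : ℕ} (y : Fin m → ℕ) : ENNReal.ofReal (l1n y) = size y := by
  rw [l1n, size, ENNReal.ofReal_sum_of_nonneg fun i _ => Nat.cast_nonneg _]
  simp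

/-- The past of length `K` of an infinite past, completed with zeros. -/
def trunc {m : ℕ} (K : ℕ) (p : ℕ → Fin m → ℕ) : ℕ → Fin m → ℕ :=
  fun k => if k < K then p k else 0

/-- A count model with infinite memory: a Lipschitz contracting mean `f` and a conditional
distribution `q` with mean `f`, depending continuously on this mean. -/
structure CountModel (m : ℕ) where
  f : (ℕ → Fin m → ℕ) → Fin m → ℝ
  q : (ℕ → Fin m → ℕ) → (Fin m → ℕ) → ℝ
  α : ℕ → ℝ
  q_nonneg : ∀ p y, 0 ≤ q p y
  hasSum_q : ∀ p, HasSum (q p) 1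
  hasSum_mean : ∀ p i, HasSum (fun y : Fin m → ℕ => (y i : ℝ) * q p y) (f p i)
  tendsto_q : ∀ p y, Tendsto (fun p' => q p' y) (comap f (𝓝 (f p))) (𝓝 (q p y))
  α_nonneg : ∀ k, 0 ≤ α k
  α_summable : Summable α
  α_lt_one : ∑' k, α k < 1
  lipschitz : ∀ y y' : ℕ → Fin m → ℕ, ENNReal.ofReal (l1 fun i => f y i - f y' i) ≤
    ∑' k, ENNReal.ofReal (α k * l1dist (y k) (y' k))

namespace CountModel

variable {m : ℕ} (M : CountModel m)

lemma q_le_one (p : ℕ → Fin m → ℕ) (y : Fin m → ℕ) : M.q p y ≤ 1 :=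
  le_hasSum (M.hasSum_q p) y fun z _ => M.q_nonneg p z

lemma f_nonneg (p : ℕ → Fin m → ℕ) (i : Fin m) : 0 ≤ M.f p i :=
  (M.hasSum_mean p i).nonneg fun y => mul_nonneg (Nat.cast_nonneg _) (M.q_nonneg p y)

/-- The sum of the Lipschitz coefficients from index `K` on. -/
def coeffTail (K : ℕ) : ENNReal := ∑' k, ENNReal.ofReal (M.α (k + K))

/-- The weighted size of a past from index `K` on. -/
def tail (K : ℕ) (p : ℕ → Fin m → ℕ) : ENNReal :=
  ∑' k, ENNReal.ofReal (M.α (k + K)) * size (p (k + K))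

lemma coeffTail_zero : M.coeffTail 0 = ENNReal.ofReal (∑' k, M.α k) := by
  simp [coeffTail, ENNReal.ofReal_tsum_of_nonneg M.α_nonneg M.α_summable]

lemma coeffTail_zero_lt_one : M.coeffTail 0 < 1 := by
  rw [coeffTail_zero, ENNReal.ofReal_lt_one]; exact M.α_lt_one

lemma tsum_add_le (g : ℕ → ENNReal) (K : ℕ) : ∑' k, g (k + K) ≤ ∑' k, g k :=
  ENNReal.tsum_comp_le_tsum_of_injective (add_left_injective K) g

lemma coeffTail_ne_top (K : ℕ) : M.coeffTail K ≠ ⊤ :=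
  ((tsum_add_le (fun k => ENNReal.ofReal (M.α k)) K).trans_lt
    ((by simpa [coeffTail] using M.coeffTail_zero_lt_one : _ < (1 : ENNReal)).trans
      ENNReal.one_lt_top)).ne

lemma tail_le (K : ℕ) (p : ℕ → Fin m → ℕ) : M.tail K p ≤ M.tail 0 p :=
  tsum_add_le (fun k => ENNReal.ofReal (M.α k) * size (p k)) K

lemma tendsto_coeffTail : Tendsto M.coeffTail atTop (𝓝 0) :=
  ENNReal.tendsto_sum_nat_add (fun k => ENNReal.ofReal (M.α k)) (M.coeffTail_ne_top 0)

lemma tendsto_tail {p : ℕ → Fin m → ℕ} (hp : M.tail 0 p ≠ ⊤) :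
    Tendsto (fun K => M.tail K p) atTop (𝓝 0) :=
  ENNReal.tendsto_sum_nat_add (fun k => ENNReal.ofReal (M.α k) * size (p k)) hp

lemma l1_sub_trunc_le (K : ℕ) (p : ℕ → Fin m → ℕ) :
    ENNReal.ofReal (l1 fun i => M.f p i - M.f (trunc K p) i) ≤ M.tail K p := by
  refine (M.lipschitz p (trunc K p)).trans ?_
  rw [← ENNReal.summable.sum_add_tsum_nat_add' (k := K), Finset.sum_eq_zero, zero_add, tail]
  · refine (tsum_congr fun k => ?_).le
    rw [ENNReal.ofReal_mul (M.α_nonneg _), ← ofReal_l1n]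
    simp [trunc, l1dist, l1n]
  · intro k hk
    simp [trunc, Finset.mem_range.1 hk, l1dist]

lemma dist_le_l1 (a b : Fin m → ℝ) : dist a b ≤ l1 fun i => a i - b i := by
  refine (dist_pi_le_iff (Finset.sum_nonneg fun i _ => abs_nonneg _)).2 fun i => ?_
  rw [Real.dist_eq]
  exact Finset.single_le_sum (f := fun i => |a i - b i|) (fun i _ => abs_nonneg _)
    (Finset.mem_univ i)

lemma dist_trunc_le {K : ℕ} {p : ℕ → Fin m → ℕ} (hp : M.tail K p ≠ ⊤) :
    dist (M.f p) (M.f (trunc K p)) ≤ (M.tail K p).toReal :=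
  (dist_le_l1 _ _).trans ((ENNReal.ofReal_le_iff_le_toReal hp).1 (M.l1_sub_trunc_le K p))

lemma sum_f_le (p : ℕ → Fin m → ℕ) : ∑ i, ENNReal.ofReal (M.f p i) ≤
    ∑ i, ENNReal.ofReal (M.f 0 i) + M.tail 0 p := by
  have h0 : trunc 0 p = 0 := by ext; simp [trunc]
  have h1 := M.l1_sub_trunc_le 0 p
  rw [h0, l1, ENNReal.ofReal_sum_of_nonneg fun i _ => abs_nonneg _] at h1
  refine le_trans ?_ (add_le_add_right h1 _)
  rw [← Finset.sum_add_distrib]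
  refine Finset.sum_le_sum fun i _ => ?_
  rw [← ENNReal.ofReal_add (M.f_nonneg 0 i) (abs_nonneg _)]
  exact ENNReal.ofReal_le_ofReal (by linarith [le_abs_self (M.f p i - M.f 0 i)])

lemma tendsto_f_trunc {p : ℕ → Fin m → ℕ} (hp : M.tail 0 p ≠ ⊤) :
    Tendsto (fun K => M.f (trunc K p)) atTop (𝓝 (M.f p)) := by
  rw [tendsto_iff_dist_tendsto_zero]
  refine squeeze_zero (fun K => dist_nonneg) (fun K => ?_)
    ((ENNReal.tendsto_toReal ENNReal.zero_ne_top).comp (M.tendsto_tail hp))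
  rw [dist_comm]
  exact M.dist_trunc_le (ne_top_of_le_ne_top hp (M.tail_le K p))

lemma tendsto_q_trunc {p : ℕ → Fin m → ℕ} (hp : M.tail 0 p ≠ ⊤) (y : Fin m → ℕ) :
    Tendsto (fun K => M.q (trunc K p) y) atTop (𝓝 (M.q p y)) :=
  (M.tendsto_q p y).comp (tendsto_comap_iff.2 (M.tendsto_f_trunc hp))

/-- The oscillation of the density at `y` over the pasts with mean `δ`-close to that of `p`. -/
def osc (y : Fin m → ℕ) (p : ℕ → Fin m → ℕ) (δ : ℝ) : ℝ :=
  ⨆ p' : {p' // dist (M.f p') (M.f p) ≤ δ}, |M.q p' y - M.q p y|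

lemma abs_q_sub_le_one (p p' : ℕ → Fin m → ℕ) (y : Fin m → ℕ) : |M.q p y - M.q p' y| ≤ 1 :=
  abs_sub_le_of_nonneg_of_le (M.q_nonneg _ _) (M.q_le_one _ _) (M.q_nonneg _ _) (M.q_le_one _ _)

lemma osc_nonneg (y : Fin m → ℕ) (p : ℕ → Fin m → ℕ) (δ : ℝ) : 0 ≤ M.osc y p δ :=
  Real.iSup_nonneg fun _ => abs_nonneg _

lemma osc_le_one (y : Fin m → ℕ) (p : ℕ → Fin m → ℕ) (δ : ℝ) : M.osc y p δ ≤ 1 :=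
  Real.iSup_le (fun _ => M.abs_q_sub_le_one _ _ _) zero_le_one

lemma abs_sub_le_osc (y : Fin m → ℕ) {p p' : ℕ → Fin m → ℕ} {δ : ℝ}
    (hd : dist (M.f p') (M.f p) ≤ δ) : |M.q p' y - M.q p y| ≤ M.osc y p δ :=
  le_ciSup (f := fun p' : {p' // dist (M.f p') (M.f p) ≤ δ} => |M.q p' y - M.q p y|)
    ⟨1, by rintro _ ⟨p', rfl⟩; exact M.abs_q_sub_le_one _ _ _⟩ ⟨p', hd⟩

/-- The scale at which the oscillation of a past truncated at `K` is measured. -/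
def scale (K : ℕ) : ℝ := √(M.coeffTail K).toReal + 1 / (K + 1)

lemma scale_pos (K : ℕ) : 0 < M.scale K := by
  unfold scale; positivity

lemma tendsto_scale : Tendsto M.scale atTop (𝓝 0) := by
  have h1 := (Real.continuous_sqrt.tendsto _).comp
    ((ENNReal.tendsto_toReal ENNReal.zero_ne_top).comp M.tendsto_coeffTail)
  change Tendsto (fun K : ℕ => √(M.coeffTail K).toReal + 1 / ((K : ℝ) + 1)) atTop (𝓝 0)
  simpa [Function.comp_def] using h1.add tendsto_one_div_add_atTop_nhds_zero_nat

lemma coeffTail_le_scale_sq (K : ℕ) : (M.coeffTail K).toReal ≤ M.scale K ^ 2 := by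
  have h1 : √(M.coeffTail K).toReal ≤ M.scale K := by
    unfold scale; linarith [Nat.one_div_pos_of_nat (n := K) (α := ℝ)]
  calc (M.coeffTail K).toReal = √(M.coeffTail K).toReal ^ 2 :=
        (Real.sq_sqrt ENNReal.toReal_nonneg).symm
    _ ≤ _ := pow_le_pow_left₀ (Real.sqrt_nonneg _) h1 2

lemma tendsto_osc {p : ℕ → Fin m → ℕ} (hp : M.tail 0 p ≠ ⊤) (y : Fin m → ℕ) :
    Tendsto (fun K => M.osc y (trunc K p) (M.scale K)) atTop (𝓝 0) := by
  rw [Metric.tendsto_atTop']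
  intro ε hε
  obtain ⟨U, hU, hUs⟩ := mem_comap.1 ((M.tendsto_q p y).eventually
    (Metric.ball_mem_nhds _ (show 0 < ε / 4 by linarith)))
  obtain ⟨δ, hδ, hδU⟩ := Metric.mem_nhds_iff.1 hU
  have hq : ∀ p', dist (M.f p') (M.f p) < δ → |M.q p' y - M.q p y| < ε / 4 := fun p' h =>
    hUs (hδU h)
  obtain ⟨K₀, hK₀⟩ := eventually_atTop.1
    (((M.tendsto_f_trunc hp).eventually (Metric.ball_mem_nhds _ (half_pos hδ))).and
      (M.tendsto_scale.eventually (gt_mem_nhds (half_pos hδ))))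
  refine ⟨K₀, fun K hK => ?_⟩
  obtain ⟨h1, h2⟩ := hK₀ K hK.le
  rw [Real.dist_eq, sub_zero, abs_of_nonneg (M.osc_nonneg _ _ _)]
  refine lt_of_le_of_lt (Real.iSup_le (a := ε / 2) ?_ (by linarith)) (by linarith)
  rintro ⟨p', hp'⟩
  have h3 := hq p' (by linarith [dist_triangle (M.f p') (M.f (trunc K p)) (M.f p)])
  have h4 := hq (trunc K p) (by linarith)
  rw [abs_lt] at h3 h4
  rw [abs_le]
  constructor <;> dsimp only <;> linarith

lemma abs_q_sub_q_trunc_le {K : ℕ} {p : ℕ → Fin m → ℕ} (hp : M.tail 0 p ≠ ⊤) (y : Fin m → ℕ) :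
    |M.q p y - M.q (trunc K p) y| ≤
      M.osc y (trunc K p) (M.scale K) + (M.tail K p).toReal / M.scale K := by
  have h0 : 0 ≤ (M.tail K p).toReal / M.scale K :=
    div_nonneg ENNReal.toReal_nonneg (M.scale_pos K).le
  rcases le_or_gt (dist (M.f p) (M.f (trunc K p))) (M.scale K) with h | h
  · linarith [M.abs_sub_le_osc y h]
  · have h1 : 1 ≤ (M.tail K p).toReal / M.scale K := by
      rw [le_div_iff₀ (M.scale_pos K), one_mul]
      exact h.le.trans (M.dist_trunc_le (ne_top_of_le_ne_top hp (M.tail_le K p)))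
    linarith [M.abs_q_sub_le_one p (trunc K p) y, M.osc_nonneg y (trunc K p) (M.scale K)]

end CountModel

end Model
section Path

variable {m : ℕ}

/-- The past before time `t` of a two-sided path. -/
def pathPast (t : ℤ) (x : ℤ → Fin m → ℕ) : ℕ → Fin m → ℕ := fun k => x (t - 1 - k)

/-- The σ-algebra on two-sided paths generated by the coordinates up to time `t`. -/
@[reducible] def pathFilt (m : ℕ) (t : ℤ) : MeasurableSpace (ℤ → Fin m → ℕ) :=
  filt (fun s (x : ℤ → Fin m → ℕ) => x s) t

/-- The cylinder of paths that agree with `b` at the times in `I`. -/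
def cyl (I : Finset ℤ) (b : ℤ → Fin m → ℕ) : Set (ℤ → Fin m → ℕ) := {x | ∀ s ∈ I, x s = b s}

/-- The cylinders with base in `S`. -/
def cylinders (m : ℕ) (S : Set ℤ) : Set (Set (ℤ → Fin m → ℕ)) :=
  {B | ∃ (I : Finset ℤ) (b : ℤ → Fin m → ℕ), (∀ s ∈ I, s ∈ S) ∧ B = cyl I b}

lemma isClopen_cyl (I : Finset ℤ) (b : ℤ → Fin m → ℕ) : IsClopen (cyl I b) := by
  have : cyl I b = ⋂ s ∈ I, (fun x : ℤ → Fin m → ℕ => x s) ⁻¹' {b s} := by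
    ext x; simp [cyl]
  rw [this]
  exact isClopen_biInter_finset fun s _ => (isClopen_discrete _).preimage (continuous_apply s)

lemma isPiSystem_cylinders (S : Set ℤ) : IsPiSystem (cylinders m S) := by
  rintro _ ⟨I, b, hI, rfl⟩ _ ⟨J, c, hJ, rfl⟩ ⟨x, hx, hx'⟩
  refine ⟨I ∪ J, x, fun s hs => (Finset.mem_union.1 hs).elim (hI s) (hJ s), ?_⟩
  ext z
  constructor
  · rintro ⟨h1, h2⟩ s hs
    rcases Finset.mem_union.1 hs with h | h
    · rw [h1 s h, hx s h]
    · rw [h2 s h, hx' s h]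
  · exact fun h => ⟨fun s hs => by rw [h s (Finset.mem_union_left _ hs), hx s hs],
      fun s hs => by rw [h s (Finset.mem_union_right _ hs), hx' s hs]⟩

lemma iSup_comap_eq_generateFrom (S : Set ℤ) :
    (⨆ s : {s : ℤ // s ∈ S}, MeasurableSpace.comap (fun x : ℤ → Fin m → ℕ => x s.1)
      inferInstance) = MeasurableSpace.generateFrom (cylinders m S) := by
  apply le_antisymm
  · refine iSup_le fun s => ?_
    rw [← measurable_iff_comap_le]
    refine @measurable_to_countable' (Fin m → ℕ) (ℤ → Fin m → ℕ) _ _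
      (MeasurableSpace.generateFrom (cylinders m S)) _ fun e => ?_
    refine MeasurableSpace.measurableSet_generateFrom ⟨{s.1}, fun _ => e, ?_, ?_⟩
    · simp
    · ext x; simp [cyl]
  · refine MeasurableSpace.generateFrom_le ?_
    rintro _ ⟨I, b, hI, rfl⟩
    have : cyl I b = ⋂ s ∈ I, (fun x : ℤ → Fin m → ℕ => x s) ⁻¹' {b s} := by
      ext x; simp [cyl]
    rw [this]
    refine Finset.measurableSet_biInter I fun s hs => ?_
    exact (le_iSup (fun s : {s : ℤ // s ∈ S} => MeasurableSpace.comap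
      (fun x : ℤ → Fin m → ℕ => x s.1) inferInstance) ⟨s, hI s hs⟩) _
      ⟨{b s}, measurableSet_singleton _, rfl⟩

lemma pathFilt_eq_generateFrom (t : ℤ) :
    pathFilt m t = MeasurableSpace.generateFrom (cylinders m (Set.Iic t)) :=
  iSup_comap_eq_generateFrom (Set.Iic t)

lemma pi_eq_generateFrom :
    (MeasurableSpace.pi : MeasurableSpace (ℤ → Fin m → ℕ)) =
      MeasurableSpace.generateFrom (cylinders m Set.univ) := by
  rw [← iSup_comap_eq_generateFrom, MeasurableSpace.pi]
  exact le_antisymm (iSup_le fun s => le_iSup (fun s : {s : ℤ // s ∈ Set.univ} =>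
    MeasurableSpace.comap (fun x : ℤ → Fin m → ℕ => x s.1) inferInstance) ⟨s, trivial⟩)
    (iSup_le fun s => le_iSup (fun s : ℤ =>
      MeasurableSpace.comap (fun x : ℤ → Fin m → ℕ => x s) inferInstance) s.1)

lemma pathFilt_le (t : ℤ) : pathFilt m t ≤ MeasurableSpace.pi :=
  iSup_le fun s => le_iSup (fun s : ℤ =>
      MeasurableSpace.comap (fun x : ℤ → Fin m → ℕ => x s) inferInstance) s.1

lemma pathFilt_mono {s t : ℤ} (h : s ≤ t) : pathFilt m s ≤ pathFilt m t :=
  iSup_le fun r => le_iSup (fun r : {r : ℤ // r ≤ t} =>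
      MeasurableSpace.comap (fun x : ℤ → Fin m → ℕ => x r.1) inferInstance) ⟨r.1, r.2.trans h⟩

lemma measurable_eval_pathFilt {s t : ℤ} (h : s ≤ t) :
    Measurable[pathFilt m t] fun x : ℤ → Fin m → ℕ => x s :=
  measurable_iff_comap_le.2 (le_iSup (fun r : {r : ℤ // r ≤ t} =>
      MeasurableSpace.comap (fun x : ℤ → Fin m → ℕ => x r.1) inferInstance) ⟨s, h⟩)

lemma measurableSet_cyl (I : Finset ℤ) (b : ℤ → Fin m → ℕ) : MeasurableSet (cyl I b) :=
  (isClopen_cyl I b).isClosed.measurableSet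

/-- Extension by zero of a finite past. -/
def extendPast {K : ℕ} (u : Fin K → Fin m → ℕ) : ℕ → Fin m → ℕ :=
  fun k => if h : k < K then u ⟨k, h⟩ else 0

lemma trunc_pathPast (K : ℕ) (t : ℤ) (x : ℤ → Fin m → ℕ) :
    trunc K (pathPast t x) = extendPast fun k : Fin K => x (t - 1 - (k : ℕ)) := by
  funext k
  by_cases h : k < K <;> simp [trunc, extendPast, pathPast, h]

lemma continuous_comp_trunc (F : (ℕ → Fin m → ℕ) → ℝ) (K : ℕ) (t : ℤ) :
    Continuous fun x : ℤ → Fin m → ℕ => F (trunc K (pathPast t x)) := by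
  simp only [trunc_pathPast]
  exact (continuous_of_discreteTopology (f := fun u : Fin K → Fin m → ℕ => F (extendPast u))).comp
    (continuous_pi fun k => continuous_apply _)

lemma measurable_comp_trunc (F : (ℕ → Fin m → ℕ) → ℝ) (K : ℕ) (t : ℤ) :
    Measurable[pathFilt m (t - 1)]
      fun x : ℤ → Fin m → ℕ => F (trunc K (pathPast t x)) := by
  simp only [trunc_pathPast]
  exact (Measurable.of_discrete (f := fun u : Fin K → Fin m → ℕ => F (extendPast u))).comp
    (@measurable_pi_lambda _ _ _ (pathFilt m (t - 1)) _ _ fun k =>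
      measurable_eval_pathFilt (by omega))

lemma measurable_size_eval (s : ℤ) : Measurable fun x : ℤ → Fin m → ℕ => size (x s) :=
  (Measurable.of_discrete (f := size)).comp (measurable_pi_apply s)

/-- All coordinates have size at most `C` in mean. -/
def MomentBound (μ : Measure (ℤ → Fin m → ℕ)) (C : ENNReal) : Prop :=
  ∀ t, ∫⁻ x, size (x t) ∂μ ≤ C

lemma continuous_integral_of_continuous {g : (ℤ → Fin m → ℕ) → ℝ} (hg : Continuous g)
    (hb : ∀ x, ‖g x‖ ≤ 1) :
    Continuous fun μ : ProbabilityMeasure (ℤ → Fin m → ℕ) => ∫ x, g x ∂(μ : Measure (ℤ → Fin m → ℕ)) :=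
  ProbabilityMeasure.continuous_integral_boundedContinuousFunction
    (BoundedContinuousFunction.ofNormedAddCommGroup g hg 1 hb)

lemma continuous_setIntegral_of_continuous {g : (ℤ → Fin m → ℕ) → ℝ} (hg : Continuous g)
    (hb : ∀ x, ‖g x‖ ≤ 1) {B : Set (ℤ → Fin m → ℕ)} (hB : IsClopen B) :
    Continuous fun μ : ProbabilityMeasure (ℤ → Fin m → ℕ) => ∫ x in B, g x ∂(μ : Measure (ℤ → Fin m → ℕ)) := by
  simp only [← integral_indicator hB.isClosed.measurableSet]
  refine continuous_integral_of_continuous (hB.continuous_indicator hg) fun x => ?_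
  exact (norm_indicator_le_norm_self g x).trans (hb x)

lemma continuous_measureReal {B : Set (ℤ → Fin m → ℕ)} (hB : IsClopen B) :
    Continuous fun μ : ProbabilityMeasure (ℤ → Fin m → ℕ) => (μ : Measure (ℤ → Fin m → ℕ)).real B := by
  simpa using continuous_setIntegral_of_continuous (g := fun _ => 1) continuous_const
    (by simp) hB

lemma isClosed_momentBound (C : ENNReal) :
    IsClosed {μ : ProbabilityMeasure (ℤ → Fin m → ℕ) | MomentBound (μ : Measure (ℤ → Fin m → ℕ)) C} := by
  have key : ∀ (μ : ProbabilityMeasure (ℤ → Fin m → ℕ)) (t : ℤ),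
      ∫⁻ x, size (x t) ∂(μ : Measure (ℤ → Fin m → ℕ)) =
        ⨆ j : ℕ, ∫⁻ x, ((min (∑ i, x t i) j : ℕ) : NNReal) ∂(μ : Measure (ℤ → Fin m → ℕ)) := by
    intro μ t
    rw [← lintegral_iSup]
    · refine lintegral_congr fun x => le_antisymm ?_ (iSup_le fun j => ?_)
      · refine le_iSup_of_le (∑ i, x t i) ?_
        simp [size]
      · simp only [size]
        exact_mod_cast min_le_left _ _
    · intro j
      exact (Measurable.of_discrete (f := fun y : Fin m → ℕ =>
        (((min (∑ i, y i) j : ℕ) : NNReal) : ENNReal))).comp (measurable_pi_apply t)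
    · intro j k hjk x
      simp only
      exact_mod_cast min_le_min_left _ hjk
  simp only [MomentBound, key, iSup_le_iff, Set.ofPred_forall]
  refine isClosed_iInter fun t => isClosed_iInter fun j => isClosed_le ?_ continuous_const
  refine ProbabilityMeasure.continuous_lintegral_boundedContinuousFunction
    (BoundedContinuousFunction.mkOfBound
      ⟨fun x : ℤ → Fin m → ℕ => ((min (∑ i, x t i) j : ℕ) : NNReal), ?_⟩ j ?_)
  · exact (continuous_of_discreteTopology (f := fun y : Fin m → ℕ =>
      ((min (∑ i, y i) j : ℕ) : NNReal))).comp (continuous_apply t)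
  · intro x z
    rw [NNReal.dist_eq, abs_le]
    have h1 : ((min (∑ i, x t i) j : ℕ) : ℝ) ≤ j := by exact_mod_cast min_le_right _ _
    have h2 : ((min (∑ i, z t i) j : ℕ) : ℝ) ≤ j := by exact_mod_cast min_le_right _ _
    have h3 : (0 : ℝ) ≤ ((min (∑ i, x t i) j : ℕ) : ℝ) := Nat.cast_nonneg _
    have h4 : (0 : ℝ) ≤ ((min (∑ i, z t i) j : ℕ) : ℝ) := Nat.cast_nonneg _
    simp only [ContinuousMap.coe_mk, NNReal.coe_natCast]
    constructor <;> linarith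

lemma finite_size_le (R : ENNReal) (hR : R ≠ ⊤) : {y : Fin m → ℕ | size y ≤ R}.Finite := by
  lift R to NNReal using hR
  refine (Set.finite_Iic (fun _ : Fin m => ⌊R⌋₊)).subset fun y hy i => Nat.le_floor ?_
  have h1 : (y i : ENNReal) ≤ R := (Finset.single_le_sum (f := fun i => (y i : ENNReal))
    (fun _ _ => zero_le) (Finset.mem_univ i)).trans hy
  exact_mod_cast h1

lemma isTight_momentBound {C : ENNReal} (hC : C ≠ ⊤) :
    IsTightMeasureSet {((μ : ProbabilityMeasure (ℤ → Fin m → ℕ)) : Measure (ℤ → Fin m → ℕ)) |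
      μ ∈ {μ : ProbabilityMeasure (ℤ → Fin m → ℕ) | MomentBound (μ : Measure (ℤ → Fin m → ℕ)) C}} := by
  rw [isTightMeasureSet_iff_exists_isCompact_measure_compl_le]
  intro ε hε
  obtain ⟨ε', hε', hsum⟩ := ENNReal.exists_pos_sum_of_countable' hε.ne' ℤ
  have hR : ∀ t, (C + 1) / ε' t ≠ ⊤ := fun t =>
    ENNReal.div_ne_top (by simp [hC]) (hε' t).ne'
  refine ⟨Set.univ.pi fun t => {y | size y ≤ (C + 1) / ε' t},
    isCompact_univ_pi fun t => (finite_size_le _ (hR t)).isCompact, ?_⟩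
  rintro _ ⟨μ, hμ, rfl⟩
  have hsub : (Set.univ.pi fun t => {y : Fin m → ℕ | size y ≤ (C + 1) / ε' t})ᶜ ⊆
      ⋃ t : ℤ, {x : ℤ → Fin m → ℕ | (C + 1) / ε' t ≤ size (x t)} := by
    intro x hx
    simp only [Set.mem_compl_iff, Set.mem_pi, Set.mem_univ, true_implies, not_forall] at hx
    obtain ⟨t, ht⟩ := hx
    exact Set.mem_iUnion.2 ⟨t, show (C + 1) / ε' t ≤ size (x t) from
      (not_le.1 (show ¬ size (x t) ≤ (C + 1) / ε' t from ht)).le⟩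
  refine (measure_mono hsub).trans ((measure_iUnion_le _).trans
    ((ENNReal.tsum_le_tsum fun t => ?_).trans hsum.le))
  by_cases htop : ε' t = ⊤
  · rw [htop]; exact le_top
  have hpos : (C + 1) / ε' t ≠ 0 := by simp [ENNReal.div_eq_zero_iff, htop]
  refine (meas_ge_le_lintegral_div (measurable_size_eval t).aemeasurable hpos (hR t)).trans ?_
  refine ENNReal.div_le_of_le_mul ?_
  rw [mul_comm, ENNReal.div_mul_cancel (hε' t).ne' htop]
  exact (hμ t).trans le_self_add

lemma isCompact_momentBound {C : ENNReal} (hC : C ≠ ⊤) :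
    IsCompact {μ : ProbabilityMeasure (ℤ → Fin m → ℕ) | MomentBound (μ : Measure (ℤ → Fin m → ℕ)) C} := by
  rw [← (isClosed_momentBound C).closure_eq]
  exact isCompact_closure_of_isTightMeasureSet (isTight_momentBound hC)

end Path
section Limit

namespace CountModel

variable {m : ℕ} (M : CountModel m) {μ : Measure (ℤ → Fin m → ℕ)} {C : ENNReal}

lemma measurable_tail (K : ℕ) (t : ℤ) :
    Measurable fun x : ℤ → Fin m → ℕ => M.tail K (pathPast t x) :=
  Measurable.tsum fun k => (measurable_size_eval (t - 1 - ((k + K : ℕ) : ℤ))).const_mul _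

lemma lintegral_tail_le (hμ : MomentBound μ C) (K : ℕ) (t : ℤ) :
    ∫⁻ x, M.tail K (pathPast t x) ∂μ ≤ M.coeffTail K * C := by
  simp only [tail, pathPast]
  rw [lintegral_tsum fun k =>
    ((measurable_size_eval (t - 1 - ((k + K : ℕ) : ℤ))).const_mul _).aemeasurable, coeffTail,
    ← ENNReal.tsum_mul_right]
  refine ENNReal.tsum_le_tsum fun k => ?_
  rw [lintegral_const_mul _ (measurable_size_eval (t - 1 - ((k + K : ℕ) : ℤ)))]
  exact mul_le_mul_right (hμ _) _

lemma lintegral_tail_ne_top (hμ : MomentBound μ C) (hC : C ≠ ⊤) (K : ℕ) (t : ℤ) :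
    ∫⁻ x, M.tail K (pathPast t x) ∂μ ≠ ⊤ :=
  ne_top_of_le_ne_top (ENNReal.mul_ne_top (M.coeffTail_ne_top K) hC) (M.lintegral_tail_le hμ K t)

lemma ae_tail_ne_top (hμ : MomentBound μ C) (hC : C ≠ ⊤) (t : ℤ) :
    ∀ᵐ x ∂μ, M.tail 0 (pathPast t x) ≠ ⊤ :=
  (ae_lt_top (M.measurable_tail 0 t) (M.lintegral_tail_ne_top hμ hC 0 t)).mono fun _ h => h.ne

lemma aestronglyMeasurable_comp_pathPast (hμ : MomentBound μ C) (hC : C ≠ ⊤) (t : ℤ)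
    {g : (ℕ → Fin m → ℕ) → ℝ}
    (hg : ∀ p, M.tail 0 p ≠ ⊤ → Tendsto (fun K => g (trunc K p)) atTop (𝓝 (g p))) :
    AEStronglyMeasurable[pathFilt m (t - 1)] (fun x => g (pathPast t x)) μ := by
  refine ⟨fun x => limsup (fun K => g (trunc K (pathPast t x))) atTop, ?_, ?_⟩
  · exact (Measurable.limsup (mδ := pathFilt m (t - 1))
      fun K => measurable_comp_trunc g K t).stronglyMeasurable
  · filter_upwards [M.ae_tail_ne_top hμ hC t] with x hx
    exact (hg _ hx).limsup_eq.symm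

lemma aestronglyMeasurable_q (hμ : MomentBound μ C) (hC : C ≠ ⊤) (t : ℤ) (y : Fin m → ℕ) :
    AEStronglyMeasurable[pathFilt m (t - 1)] (fun x => M.q (pathPast t x) y) μ :=
  M.aestronglyMeasurable_comp_pathPast (g := fun p => M.q p y) hμ hC t
    fun _ hp => M.tendsto_q_trunc hp y

lemma aestronglyMeasurable_f (hμ : MomentBound μ C) (hC : C ≠ ⊤) (t : ℤ) (i : Fin m) :
    AEStronglyMeasurable[pathFilt m (t - 1)] (fun x => M.f (pathPast t x) i) μ :=
  M.aestronglyMeasurable_comp_pathPast (g := fun p => M.f p i) hμ hC t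
    fun _ hp => tendsto_pi_nhds.1 (M.tendsto_f_trunc hp) i

lemma norm_q_le_one (p : ℕ → Fin m → ℕ) (y : Fin m → ℕ) : ‖M.q p y‖ ≤ 1 := by
  rw [Real.norm_of_nonneg (M.q_nonneg p y)]; exact M.q_le_one p y

lemma norm_osc_le_one (y : Fin m → ℕ) (p : ℕ → Fin m → ℕ) (δ : ℝ) : ‖M.osc y p δ‖ ≤ 1 := by
  rw [Real.norm_of_nonneg (M.osc_nonneg y p δ)]; exact M.osc_le_one y p δ

lemma integrable_q [IsFiniteMeasure μ] (hμ : MomentBound μ C) (hC : C ≠ ⊤) (t : ℤ)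
    (y : Fin m → ℕ) : Integrable (fun x => M.q (pathPast t x) y) μ :=
  Integrable.of_bound ((M.aestronglyMeasurable_q hμ hC t y).mono (pathFilt_le _)) 1
    (.of_forall fun _ => M.norm_q_le_one _ _)

lemma integrable_comp_trunc [IsFiniteMeasure μ] {F : (ℕ → Fin m → ℕ) → ℝ} (hF : ∀ p, ‖F p‖ ≤ 1)
    (K : ℕ) (t : ℤ) : Integrable (fun x => F (trunc K (pathPast t x))) μ :=
  Integrable.of_bound (continuous_comp_trunc F K t).aestronglyMeasurable 1
    (.of_forall fun _ => hF _)

/-- The error made when the law of the coordinate at time `t` is replaced by the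
conditional distribution of the model, on the event `B`. -/
def defect (μ : Measure (ℤ → Fin m → ℕ)) (t : ℤ) (y : Fin m → ℕ) (B : Set (ℤ → Fin m → ℕ)) : ℝ :=
  μ.real (B ∩ {x | x t = y}) - ∫ x in B, M.q (pathPast t x) y ∂μ

/-- The variant of `CountModel.defect` in which the past is truncated. -/
def truncDefect (K : ℕ) (μ : Measure (ℤ → Fin m → ℕ)) (t : ℤ) (y : Fin m → ℕ)
    (B : Set (ℤ → Fin m → ℕ)) : ℝ :=
  μ.real (B ∩ {x | x t = y}) - ∫ x in B, M.q (trunc K (pathPast t x)) y ∂μ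

/-- A bound for the distance between `CountModel.defect` and `CountModel.truncDefect`. -/
def truncError (C : ENNReal) (K : ℕ) (μ : Measure (ℤ → Fin m → ℕ)) (t : ℤ) (y : Fin m → ℕ) : ℝ :=
  ∫ x, M.osc y (trunc K (pathPast t x)) (M.scale K) ∂μ + C.toReal * M.scale K

lemma abs_defect_sub_truncDefect_le [IsProbabilityMeasure μ] (hμ : MomentBound μ C) (hC : C ≠ ⊤)
    (K : ℕ) (t : ℤ) (y : Fin m → ℕ) (B : Set (ℤ → Fin m → ℕ)) :
    |M.defect μ t y B - M.truncDefect K μ t y B| ≤ M.truncError C K μ t y := by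
  have hq := M.integrable_q hμ hC t y
  have hqK : Integrable (fun x => M.q (trunc K (pathPast t x)) y) μ :=
    integrable_comp_trunc (F := fun p => M.q p y) (fun p => M.norm_q_le_one p y) K t
  have hosc : Integrable (fun x => M.osc y (trunc K (pathPast t x)) (M.scale K)) μ :=
    integrable_comp_trunc (F := fun p => M.osc y p (M.scale K))
      (fun p => M.norm_osc_le_one y p _) K t
  have htail : Integrable (fun x => (M.tail K (pathPast t x)).toReal) μ :=
    integrable_toReal_of_lintegral_ne_top (M.measurable_tail K t).aemeasurable
      (M.lintegral_tail_ne_top hμ hC K t)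
  have htail_le : ∫ x, (M.tail K (pathPast t x)).toReal ∂μ ≤ (M.coeffTail K).toReal * C.toReal := by
    rw [integral_toReal (M.measurable_tail K t).aemeasurable
      (ae_lt_top (M.measurable_tail K t) (M.lintegral_tail_ne_top hμ hC K t)), ← ENNReal.toReal_mul]
    exact ENNReal.toReal_mono (ENNReal.mul_ne_top (M.coeffTail_ne_top K) hC)
      (M.lintegral_tail_le hμ K t)
  have heq : M.defect μ t y B - M.truncDefect K μ t y B =
      -∫ x in B, (M.q (pathPast t x) y - M.q (trunc K (pathPast t x)) y) ∂μ := by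
    rw [integral_sub hq.integrableOn hqK.integrableOn, defect, truncDefect]; ring
  have hdiv : (∫ x, (M.tail K (pathPast t x)).toReal ∂μ) / M.scale K ≤
      C.toReal * M.scale K := by
    rw [div_le_iff₀ (M.scale_pos K)]
    nlinarith [M.coeffTail_le_scale_sq K, ENNReal.toReal_nonneg (a := C)]
  rw [heq, abs_neg, truncError]
  calc |∫ x in B, (M.q (pathPast t x) y - M.q (trunc K (pathPast t x)) y) ∂μ|
      ≤ ∫ x in B, |M.q (pathPast t x) y - M.q (trunc K (pathPast t x)) y| ∂μ :=
        abs_integral_le_integral_abs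
    _ ≤ ∫ x, |M.q (pathPast t x) y - M.q (trunc K (pathPast t x)) y| ∂μ :=
        setIntegral_le_integral (hq.sub hqK).abs (.of_forall fun _ => abs_nonneg _)
    _ ≤ ∫ x, (M.osc y (trunc K (pathPast t x)) (M.scale K) +
          (M.tail K (pathPast t x)).toReal / M.scale K) ∂μ := by
        refine integral_mono_ae (hq.sub hqK).abs (hosc.add (htail.div_const _)) ?_
        filter_upwards [M.ae_tail_ne_top hμ hC t] with x hx
        exact M.abs_q_sub_q_trunc_le hx y
    _ ≤ _ := by
        rw [integral_add hosc (htail.div_const _), integral_div]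
        linarith

lemma tendsto_truncError [IsProbabilityMeasure μ] (hμ : MomentBound μ C) (hC : C ≠ ⊤) (t : ℤ)
    (y : Fin m → ℕ) : Tendsto (fun K => M.truncError C K μ t y) atTop (𝓝 0) := by
  have h1 : Tendsto (fun K => ∫ x, M.osc y (trunc K (pathPast t x)) (M.scale K) ∂μ) atTop
      (𝓝 (∫ _, 0 ∂μ)) := by
    refine tendsto_integral_of_dominated_convergence (fun _ => 1) (fun K => ?_)
      (integrable_const _) (fun K => .of_forall fun x => M.norm_osc_le_one _ _ _) ?_
    · exact (continuous_comp_trunc (fun p => M.osc y p (M.scale K)) K t).aestronglyMeasurable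
    · filter_upwards [M.ae_tail_ne_top hμ hC t] with x hx
      exact M.tendsto_osc hx y
  simpa [truncError] using h1.add (M.tendsto_scale.const_mul C.toReal)

lemma isClopen_eval_eq (t : ℤ) (y : Fin m → ℕ) :
    IsClopen {x : ℤ → Fin m → ℕ | x t = y} :=
  (isClopen_discrete {y}).preimage (continuous_apply t)

lemma continuous_truncDefect (K : ℕ) (t : ℤ) (y : Fin m → ℕ) {B : Set (ℤ → Fin m → ℕ)}
    (hB : IsClopen B) : Continuous fun μ : ProbabilityMeasure (ℤ → Fin m → ℕ) =>
      M.truncDefect K (μ : Measure (ℤ → Fin m → ℕ)) t y B :=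
  (continuous_measureReal (hB.inter (isClopen_eval_eq t y))).sub
    (continuous_setIntegral_of_continuous (continuous_comp_trunc (fun p => M.q p y) K t)
      (fun _ => M.norm_q_le_one _ _) hB)

lemma continuous_truncError (C : ENNReal) (K : ℕ) (t : ℤ) (y : Fin m → ℕ) :
    Continuous fun μ : ProbabilityMeasure (ℤ → Fin m → ℕ) =>
      M.truncError C K (μ : Measure (ℤ → Fin m → ℕ)) t y :=
  (continuous_integral_of_continuous
    (continuous_comp_trunc (fun p => M.osc y p (M.scale K)) K t)
    (fun _ => M.norm_osc_le_one _ _ _)).add continuous_const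

lemma defect_eq_zero_of_tendsto {ι : Type*} {l : Filter ι} [l.NeBot]
    {ν : ι → ProbabilityMeasure (ℤ → Fin m → ℕ)} {μ : ProbabilityMeasure (ℤ → Fin m → ℕ)}
    (hlim : Tendsto ν l (𝓝 μ)) (hC : C ≠ ⊤)
    (hν : ∀ᶠ i in l, MomentBound (ν i : Measure (ℤ → Fin m → ℕ)) C)
    (hμ : MomentBound (μ : Measure (ℤ → Fin m → ℕ)) C) {t : ℤ} {y : Fin m → ℕ}
    {B : Set (ℤ → Fin m → ℕ)} (hB : IsClopen B)
    (hdef : Tendsto (fun i => M.defect (ν i : Measure (ℤ → Fin m → ℕ)) t y B) l (𝓝 0)) :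
    M.defect (μ : Measure (ℤ → Fin m → ℕ)) t y B = 0 := by
  have key : ∀ K, |M.defect (μ : Measure (ℤ → Fin m → ℕ)) t y B| ≤
      M.truncError C K (μ : Measure (ℤ → Fin m → ℕ)) t y +
      M.truncError C K (μ : Measure (ℤ → Fin m → ℕ)) t y := by
    intro K
    have h1 : |M.truncDefect K (μ : Measure (ℤ → Fin m → ℕ)) t y B| ≤
        |(0 : ℝ)| + M.truncError C K (μ : Measure (ℤ → Fin m → ℕ)) t y := by
      refine le_of_tendsto_of_tendsto
        (((M.continuous_truncDefect K t y hB).tendsto μ).comp hlim).abs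
        (hdef.abs.add (((M.continuous_truncError C K t y).tendsto μ).comp hlim)) ?_
      filter_upwards [hν] with i hi
      have := M.abs_defect_sub_truncDefect_le hi hC K t y B
      have h2 := abs_sub_abs_le_abs_sub (M.truncDefect K (ν i : Measure (ℤ → Fin m → ℕ)) t y B)
        (M.defect (ν i : Measure (ℤ → Fin m → ℕ)) t y B)
      rw [abs_sub_comm] at h2
      simp only [Function.comp_apply]
      linarith
    have h2 := abs_sub_abs_le_abs_sub (M.defect (μ : Measure (ℤ → Fin m → ℕ)) t y B)
      (M.truncDefect K (μ : Measure (ℤ → Fin m → ℕ)) t y B)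
    have h3 := M.abs_defect_sub_truncDefect_le hμ hC K t y B
    rw [abs_zero] at h1
    linarith
  have h0 := (M.tendsto_truncError hμ hC t y).add (M.tendsto_truncError hμ hC t y)
  rw [add_zero] at h0
  exact abs_nonpos_iff.1 (ge_of_tendsto' h0 key)

/-- The measure is invariant under the shift, tested on cylinders. -/
def CylStationary (μ : Measure (ℤ → Fin m → ℕ)) : Prop :=
  ∀ I b, μ.real (shift ⁻¹' cyl I b) = μ.real (cyl I b)

/-- The conditional distributions are those of the model, tested on cylinders. -/
def CylSolution (μ : Measure (ℤ → Fin m → ℕ)) : Prop :=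
  ∀ t y I b, (∀ s ∈ I, s ≤ t - 1) → M.defect μ t y (cyl I b) = 0

/-- The laws of stationary solutions with mean size at most `C`. -/
def solutions (C : ENNReal) : Set (ProbabilityMeasure (ℤ → Fin m → ℕ)) :=
  {μ | MomentBound (μ : Measure (ℤ → Fin m → ℕ)) C ∧
    CylStationary (μ : Measure (ℤ → Fin m → ℕ)) ∧ M.CylSolution (μ : Measure (ℤ → Fin m → ℕ))}

lemma continuous_shift : Continuous (shift : (ℤ → Fin m → ℕ) → ℤ → Fin m → ℕ) :=
  continuous_pi fun t => continuous_apply (t + 1)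

lemma measurable_shift : Measurable (shift : (ℤ → Fin m → ℕ) → ℤ → Fin m → ℕ) :=
  continuous_shift.measurable

/-- A cluster point of asymptotic solutions is a solution. -/
lemma mem_solutions_of_tendsto {ι : Type*} {l : Filter ι} [l.NeBot]
    {ν : ι → ProbabilityMeasure (ℤ → Fin m → ℕ)} {μ : ProbabilityMeasure (ℤ → Fin m → ℕ)}
    (hlim : Tendsto ν l (𝓝 μ)) (hC : C ≠ ⊤)
    (hν : ∀ᶠ i in l, MomentBound (ν i : Measure (ℤ → Fin m → ℕ)) C)
    (hstat : ∀ I b, Tendsto (fun i => (ν i : Measure (ℤ → Fin m → ℕ)).real (shift ⁻¹' cyl I b) -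
      (ν i : Measure (ℤ → Fin m → ℕ)).real (cyl I b)) l (𝓝 0))
    (hdef : ∀ t y I b, (∀ s ∈ I, s ≤ t - 1) →
      Tendsto (fun i => M.defect (ν i : Measure (ℤ → Fin m → ℕ)) t y (cyl I b)) l (𝓝 0)) :
    μ ∈ M.solutions C := by
  have hμ : MomentBound (μ : Measure (ℤ → Fin m → ℕ)) C :=
    (isClosed_momentBound C).mem_of_tendsto hlim hν
  refine ⟨hμ, fun I b => ?_, fun t y I b hI =>
    M.defect_eq_zero_of_tendsto hlim hC hν hμ (isClopen_cyl I b) (hdef t y I b hI)⟩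
  have h1 := ((continuous_measureReal ((isClopen_cyl I b).preimage continuous_shift)).sub
    (continuous_measureReal (isClopen_cyl I b))).tendsto μ |>.comp hlim
  exact sub_eq_zero.1 (tendsto_nhds_unique h1 (hstat I b))

lemma isCompact_solutions (hC : C ≠ ⊤) : IsCompact (M.solutions C) := by
  refine (isCompact_momentBound hC).of_isClosed_subset ?_ fun μ hμ => hμ.1
  refine isClosed_iff_clusterPt.2 fun μ hμ => ?_
  have : (𝓝 μ ⊓ 𝓟 (M.solutions C)).NeBot := hμ
  have hev : ∀ᶠ ν in 𝓝 μ ⊓ 𝓟 (M.solutions C), ν ∈ M.solutions C :=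
    mem_inf_of_right (mem_principal_self _)
  refine M.mem_solutions_of_tendsto (ν := id) (tendsto_id.mono_left inf_le_left) hC
    (hev.mono fun ν hν => hν.1) (fun I b => ?_) fun t y I b hI => ?_
  · exact tendsto_const_nhds.congr' (hev.mono fun ν hν => (sub_eq_zero.2 (hν.2.1 I b)).symm)
  · exact tendsto_const_nhds.congr' (hev.mono fun ν hν => (hν.2.2 t y I b hI).symm)

end CountModel

end Limit
section Existence

namespace CountModel

variable {m : ℕ} (M : CountModel m)

/-- The conditional law of the next value given the past `p`. -/
def condLaw (p : ℕ → Fin m → ℕ) : PMF (Fin m → ℕ) :=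
  ⟨fun y => ENNReal.ofReal (M.q p y), by
    have h := ENNReal.ofReal_tsum_of_nonneg (M.q_nonneg p) (M.hasSum_q p).summable
    rw [(M.hasSum_q p).tsum_eq, ENNReal.ofReal_one] at h
    rw [h]
    exact ENNReal.summable.hasSum⟩

lemma lintegral_condLaw (p : ℕ → Fin m → ℕ) (g : (Fin m → ℕ) → ENNReal) :
    ∫⁻ y, g y ∂(M.condLaw p).toMeasure = ∑' y, g y * ENNReal.ofReal (M.q p y) := by
  rw [lintegral_countable']
  refine tsum_congr fun y => ?_
  rw [PMF.toMeasure_apply_singleton _ _ (measurableSet_singleton y)]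
  rfl

lemma tsum_mul_ofReal_q (p : ℕ → Fin m → ℕ) (i : Fin m) :
    ∑' y : Fin m → ℕ, (y i : ENNReal) * ENNReal.ofReal (M.q p y) = ENNReal.ofReal (M.f p i) := by
  rw [← (M.hasSum_mean p i).tsum_eq, ENNReal.ofReal_tsum_of_nonneg
    (fun y => mul_nonneg (Nat.cast_nonneg _) (M.q_nonneg p y)) (M.hasSum_mean p i).summable]
  refine tsum_congr fun y => ?_
  rw [ENNReal.ofReal_mul (Nat.cast_nonneg _), ENNReal.ofReal_natCast]

lemma tsum_size_mul_ofReal_q (p : ℕ → Fin m → ℕ) :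
    ∑' y : Fin m → ℕ, size y * ENNReal.ofReal (M.q p y) = ∑ i, ENNReal.ofReal (M.f p i) := by
  simp only [size, Finset.sum_mul]
  rw [Summable.tsum_finsetSum fun i _ => ENNReal.summable]
  exact Finset.sum_congr rfl fun i _ => M.tsum_mul_ofReal_q p i

/-- The past of a trajectory started at time `0`, completed with zeros. -/
def histPast {a : ℕ} (u : Finset.Iic a → Fin m → ℕ) : ℕ → Fin m → ℕ :=
  fun k => if k ≤ a then u ⟨a - k, Finset.mem_Iic.2 (Nat.sub_le a k)⟩ else 0

/-- The transition kernels of the model started from an empty past. -/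
def transition (a : ℕ) : ProbabilityTheory.Kernel (Finset.Iic a → Fin m → ℕ) (Fin m → ℕ) where
  toFun u := (M.condLaw (histPast u)).toMeasure
  measurable' := Measurable.of_discrete

instance (a : ℕ) : ProbabilityTheory.IsMarkovKernel (M.transition a) :=
  ⟨fun u => inferInstanceAs (IsProbabilityMeasure (M.condLaw (histPast u)).toMeasure)⟩

/-- The law of the model started from an empty past. -/
def startedLaw : Measure (ℕ → Fin m → ℕ) :=
  ProbabilityTheory.Kernel.traj (X := fun _ => Fin m → ℕ) M.transition 0 0

instance : IsProbabilityMeasure M.startedLaw := by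
  unfold startedLaw; infer_instance

lemma lintegral_startedLaw (a : ℕ) (φ : (Finset.Iic a → Fin m → ℕ) → (Fin m → ℕ) → ENNReal) :
    ∫⁻ z, φ (Preorder.frestrictLe (π := fun _ => Fin m → ℕ) a z) (z (a + 1)) ∂M.startedLaw =
    ∫⁻ z, ∑' y, φ (Preorder.frestrictLe (π := fun _ => Fin m → ℕ) a z) y *
      ENNReal.ofReal (M.q (histPast (Preorder.frestrictLe (π := fun _ => Fin m → ℕ) a z)) y)
      ∂M.startedLaw := by
  have h := ProbabilityTheory.Kernel.partialTraj_compProd_eq_map_traj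
    (X := fun _ => Fin m → ℕ) (κ := M.transition) (zero_le (a := a)) (x₀ := 0)
  have hφ : Measurable (Function.uncurry φ) := Measurable.of_discrete
  have h1 : ∫⁻ w, Function.uncurry φ w ∂((ProbabilityTheory.Kernel.traj
      (X := fun _ => Fin m → ℕ) M.transition 0 0).map
      (fun x => (Preorder.frestrictLe (π := fun _ => Fin m → ℕ) a x, x (a + 1)))) =
      ∫⁻ z, φ (Preorder.frestrictLe (π := fun _ => Fin m → ℕ) a z) (z (a + 1)) ∂M.startedLaw := by
    rw [lintegral_map hφ (by fun_prop)]; rfl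
  rw [← h1, ← h, Measure.lintegral_compProd hφ,
    ← ProbabilityTheory.Kernel.traj_map_frestrictLe_apply,
    lintegral_map Measurable.of_discrete (by fun_prop)]
  exact lintegral_congr fun z => M.lintegral_condLaw _ _

/-- The bound for the mean size of stationary solutions. -/
def meanBound : ENNReal := (∑ i, ENNReal.ofReal (M.f 0 i)) / (1 - M.coeffTail 0)

lemma meanBound_ne_top : M.meanBound ≠ ⊤ :=
  ENNReal.div_ne_top (by simp) (tsub_pos_of_lt M.coeffTail_zero_lt_one).ne'

lemma add_mul_meanBound :
    ∑ i, ENNReal.ofReal (M.f 0 i) + M.coeffTail 0 * M.meanBound = M.meanBound := by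
  have h1 : ∑ i, ENNReal.ofReal (M.f 0 i) = (1 - M.coeffTail 0) * M.meanBound :=
    (ENNReal.mul_div_cancel (tsub_pos_of_lt M.coeffTail_zero_lt_one).ne'
      (ne_top_of_le_ne_top ENNReal.one_ne_top tsub_le_self)).symm
  rw [h1, ← add_mul, tsub_add_cancel_of_le M.coeffTail_zero_lt_one.le, one_mul]

lemma startedLaw_zero : ∀ᵐ z ∂M.startedLaw, z 0 = 0 := by
  have h := ProbabilityTheory.Kernel.traj_map_frestrictLe_apply
    (X := fun _ => Fin m → ℕ) (κ := M.transition) 0 0 0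
  rw [ProbabilityTheory.Kernel.partialTraj_self, ProbabilityTheory.Kernel.id_apply] at h
  have h1 : ∀ᵐ u ∂(M.startedLaw.map (Preorder.frestrictLe (π := fun _ => Fin m → ℕ) 0)),
      u ⟨0, Finset.mem_Iic.2 le_rfl⟩ = 0 := by
    rw [startedLaw, h, ae_dirac_eq]
    rfl
  exact ae_of_ae_map (by fun_prop) h1

lemma lintegral_size_startedLaw_le (n : ℕ) :
    ∫⁻ z, size (z n) ∂M.startedLaw ≤ M.meanBound := by
  induction n using Nat.strong_induction_on with
  | _ n ih =>
  rcases n with _ | a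
  · rw [lintegral_congr_ae (g := fun _ => 0) (M.startedLaw_zero.mono fun z hz => by
      simp [hz, size])]
    simp
  · rw [M.lintegral_startedLaw a fun _ y => size y]
    simp only [M.tsum_size_mul_ofReal_q]
    refine (lintegral_mono fun z => M.sum_f_le _).trans ?_
    rw [lintegral_add_left measurable_const, lintegral_const, measure_univ, mul_one,
      ← M.add_mul_meanBound]
    refine add_le_add_right ?_ _
    have hmeas : ∀ k, Measurable fun z : ℕ → Fin m → ℕ =>
        size (histPast (Preorder.frestrictLe (π := fun _ => Fin m → ℕ) a z) k) := fun k =>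
      (Measurable.of_discrete (f := fun u : Finset.Iic a → Fin m → ℕ =>
        size (histPast u k))).comp (by fun_prop)
    simp only [tail]
    rw [lintegral_tsum fun k => ((hmeas _).const_mul _).aemeasurable, coeffTail,
      ← ENNReal.tsum_mul_right]
    refine ENNReal.tsum_le_tsum fun k => ?_
    rw [lintegral_const_mul _ (hmeas _)]
    refine mul_le_mul_right ?_ _
    by_cases hk : k ≤ a
    · have := ih (a - k) (by omega)
      simpa [histPast, hk] using this
    · simp [histPast, hk, size]

/-- The two-sided path which follows the trajectory `z` from time `-j` on, and vanishes before. -/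
def embed (j : ℕ) (z : ℕ → Fin m → ℕ) : ℤ → Fin m → ℕ :=
  fun t => if 0 ≤ t + j then z (t + j).toNat else 0

lemma measurable_embed (j : ℕ) : Measurable (embed j : (ℕ → Fin m → ℕ) → ℤ → Fin m → ℕ) := by
  refine measurable_pi_lambda _ fun t => ?_
  by_cases h : 0 ≤ t + j <;> simp only [embed, h, if_true, if_false] <;> fun_prop

lemma shift_embed (j : ℕ) (z : ℕ → Fin m → ℕ) : shift (embed j z) = embed (j + 1) z := by
  funext t
  simp only [shift, embed]
  rw [show t + 1 + (j : ℤ) = t + ((j + 1 : ℕ) : ℤ) by push_cast; ring]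

/-- The law of the model started at time `-j` from an empty past. -/
def startedPathLaw (j : ℕ) : Measure (ℤ → Fin m → ℕ) := M.startedLaw.map (embed j)

instance (j : ℕ) : IsProbabilityMeasure (M.startedPathLaw j) :=
  Measure.isProbabilityMeasure_map (measurable_embed j).aemeasurable

lemma momentBound_startedPathLaw (j : ℕ) : MomentBound (M.startedPathLaw j) M.meanBound := by
  intro t
  rw [startedPathLaw, lintegral_map (measurable_size_eval t) (measurable_embed j)]
  by_cases h : 0 ≤ t + j
  · simpa only [embed, h, if_true] using M.lintegral_size_startedLaw_le _
  · simp [embed, h, size]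

lemma pathPast_embed {j a : ℕ} {t : ℤ} (h : t + j = a + 1) (z : ℕ → Fin m → ℕ) :
    pathPast t (embed j z) = histPast (Preorder.frestrictLe (π := fun _ => Fin m → ℕ) a z) := by
  funext k
  simp only [pathPast, embed, histPast, Preorder.frestrictLe_apply]
  by_cases hk : k ≤ a
  · rw [if_pos hk, if_pos (by omega)]
    congr 1
    omega
  · rw [if_neg hk, if_neg (by omega)]

lemma defect_startedPathLaw {j : ℕ} {t : ℤ} (h : 1 ≤ t + j) (y : Fin m → ℕ) (I : Finset ℤ)
    (b : ℤ → Fin m → ℕ) (hI : ∀ s ∈ I, s ≤ t - 1) :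
    M.defect (M.startedPathLaw j) t y (cyl I b) = 0 := by
  obtain ⟨a, ha⟩ : ∃ a : ℕ, t + j = a + 1 := ⟨(t + j - 1).toNat, by omega⟩
  let R := Preorder.frestrictLe (π := fun _ => Fin m → ℕ) a
  let D : Set (Finset.Iic a → Fin m → ℕ) :=
    {u | ∀ s ∈ I, (if 0 ≤ s + j then histPast u (a - (s + j).toNat) else 0) = b s}
  have hD : ∀ z, embed j z ∈ cyl I b ↔ R z ∈ D := by
    intro z
    refine forall₂_congr fun s hs => ?_
    have := hI s hs
    simp only [embed, histPast, R, Preorder.frestrictLe_apply, Nat.sub_le, if_true]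
    by_cases hs0 : 0 ≤ s + j
    · simp only [hs0, if_true]
      rw [show a - (a - (s + j).toNat) = (s + j).toNat by omega]
    · simp only [hs0, if_false]
  have hmeasR : Measurable R := by fun_prop
  have h1 : M.startedLaw {z | R z ∈ D ∧ z (a + 1) = y} =
      ∫⁻ z in R ⁻¹' D, ENNReal.ofReal (M.q (histPast (R z)) y) ∂M.startedLaw := by
    classical
    have hk := M.lintegral_startedLaw a fun u y' => if u ∈ D ∧ y' = y then 1 else 0
    rw [← lintegral_indicator (hmeasR (MeasurableSet.of_discrete (s := D)))]
    have hms : MeasurableSet {z : ℕ → Fin m → ℕ | R z ∈ D ∧ z (a + 1) = y} :=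
      (hmeasR (MeasurableSet.of_discrete (s := D))).inter
        (show MeasurableSet ((fun z : ℕ → Fin m → ℕ => z (a + 1)) ⁻¹' {y}) from
          measurable_pi_apply (a + 1) (measurableSet_singleton y))
    rw [← lintegral_indicator_one hms]
    refine Eq.trans (lintegral_congr fun z => ?_) (hk.trans (lintegral_congr fun z => ?_))
    · by_cases hz : R z ∈ D ∧ z (a + 1) = y
      · rw [Set.indicator_of_mem (show z ∈ {z | R z ∈ D ∧ z (a + 1) = y} from hz), if_pos hz]; rfl
      · rw [Set.indicator_of_notMem (show z ∉ {z | R z ∈ D ∧ z (a + 1) = y} from hz), if_neg hz]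
    · rw [tsum_eq_single y fun y' hy' => by simp [hy']]
      by_cases hz : R z ∈ D
      · rw [if_pos ⟨hz, rfl⟩, one_mul, Set.indicator_of_mem (show z ∈ R ⁻¹' D from hz)]
      · rw [if_neg fun h => hz h.1, zero_mul, Set.indicator_of_notMem (show z ∉ R ⁻¹' D from hz)]
  have hqm : AEStronglyMeasurable (fun x => M.q (pathPast t x) y) (M.startedPathLaw j) :=
    (M.aestronglyMeasurable_q (M.momentBound_startedPathLaw j) M.meanBound_ne_top t y).mono
      (pathFilt_le _)
  have hpre : embed j ⁻¹' cyl I b = R ⁻¹' D := Set.ext hD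
  have hpre' : embed j ⁻¹' (cyl I b ∩ {x | x t = y}) = {z | R z ∈ D ∧ z (a + 1) = y} := by
    ext z
    refine and_congr (hD z) ?_
    have h0 : embed j z t = z (a + 1) := by
      simp only [embed]
      rw [if_pos (by omega)]
      congr 1
      omega
    simp [h0]
  rw [defect, sub_eq_zero, startedPathLaw, setIntegral_map (measurableSet_cyl I b) hqm
    (measurable_embed j).aemeasurable, measureReal_def, Measure.map_apply (measurable_embed j)
    ((measurableSet_cyl I b).inter (isClopen_eval_eq t y).isClosed.measurableSet), hpre, hpre', h1]
  simp only [pathPast_embed ha]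
  rw [integral_eq_lintegral_of_nonneg_ae (.of_forall fun _ => M.q_nonneg _ _)]
  exact ((Measurable.of_discrete (f := fun u => M.q (histPast u) y)).comp
    hmeasR).aestronglyMeasurable

/-- The average of the laws of the model started at the times `0, -1, …, -n`. -/
def averagedLaw (n : ℕ) : Measure (ℤ → Fin m → ℕ) :=
  ((n + 1 : ℕ) : ENNReal)⁻¹ • ∑ j ∈ Finset.range (n + 1), M.startedPathLaw j

instance (n : ℕ) : IsProbabilityMeasure (M.averagedLaw n) := by
  constructor
  simp only [averagedLaw, Measure.smul_apply, Measure.finsetSum_apply, measure_univ, sum_const,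
    card_range, nsmul_eq_mul, mul_one, smul_eq_mul]
  exact ENNReal.inv_mul_cancel (by simp) (ENNReal.natCast_ne_top _)

lemma averagedLaw_real (n : ℕ) (B : Set (ℤ → Fin m → ℕ)) : (M.averagedLaw n).real B =
    ((n + 1 : ℕ) : ℝ)⁻¹ * ∑ j ∈ Finset.range (n + 1), (M.startedPathLaw j).real B := by
  simp only [measureReal_def, averagedLaw, Measure.smul_apply, Measure.finsetSum_apply, smul_eq_mul]
  rw [ENNReal.toReal_mul, ENNReal.toReal_sum fun j _ => measure_ne_top _ _, ENNReal.toReal_inv,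
    ENNReal.toReal_natCast]

lemma momentBound_averagedLaw (n : ℕ) : MomentBound (M.averagedLaw n) M.meanBound := by
  intro t
  rw [averagedLaw, lintegral_smul_measure, lintegral_finsetSum_measure, smul_eq_mul]
  calc ((n + 1 : ℕ) : ENNReal)⁻¹ * ∑ j ∈ Finset.range (n + 1), ∫⁻ x, size (x t) ∂M.startedPathLaw j
      ≤ ((n + 1 : ℕ) : ENNReal)⁻¹ * ∑ j ∈ Finset.range (n + 1), M.meanBound :=
        mul_le_mul_right (Finset.sum_le_sum fun j _ => M.momentBound_startedPathLaw j t) _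
    _ = M.meanBound := by
        rw [sum_const, card_range, nsmul_eq_mul, ← mul_assoc,
          ENNReal.inv_mul_cancel (by simp) (ENNReal.natCast_ne_top _), one_mul]

lemma defect_averagedLaw (n : ℕ) (t : ℤ) (y : Fin m → ℕ) {B : Set (ℤ → Fin m → ℕ)}
    (hB : MeasurableSet B) : M.defect (M.averagedLaw n) t y B =
    ((n + 1 : ℕ) : ℝ)⁻¹ * ∑ j ∈ Finset.range (n + 1), M.defect (M.startedPathLaw j) t y B := by
  have hint : ∀ j ∈ Finset.range (n + 1), Integrable (B.indicator fun x => M.q (pathPast t x) y)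
      (M.startedPathLaw j) := fun j _ =>
    (M.integrable_q (M.momentBound_startedPathLaw j) M.meanBound_ne_top t y).indicator hB
  simp only [defect, averagedLaw_real, Finset.sum_sub_distrib, mul_sub, ← integral_indicator hB]
  rw [averagedLaw, integral_smul_measure, integral_finsetSum_measure hint, ENNReal.toReal_inv,
    ENNReal.toReal_natCast, smul_eq_mul]

lemma tendsto_average {u : ℕ → ℝ} (hu : Tendsto u atTop (𝓝 0)) :
    Tendsto (fun n : ℕ => ((n + 1 : ℕ) : ℝ)⁻¹ * ∑ j ∈ Finset.range (n + 1), u j) atTop (𝓝 0) :=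
  hu.cesaro.comp (tendsto_add_atTop_nat 1)

lemma solutions_nonempty : (M.solutions M.meanBound).Nonempty := by
  let ν : ℕ → ProbabilityMeasure (ℤ → Fin m → ℕ) := fun n => ⟨M.averagedLaw n, inferInstance⟩
  let l : Ultrafilter ℕ := Ultrafilter.of atTop
  have hl : (l : Filter ℕ) ≤ atTop := Ultrafilter.of_le atTop
  obtain ⟨μ, -, hμ⟩ := (isCompact_momentBound M.meanBound_ne_top).ultrafilter_le_nhds (l.map ν)
    (le_principal_iff.2 (Filter.mem_map.2 (Filter.Eventually.of_forall
      fun n => M.momentBound_averagedLaw n)))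
  refine ⟨μ, M.mem_solutions_of_tendsto (l := (l : Filter ℕ)) (ν := ν) hμ M.meanBound_ne_top
    (.of_forall fun n => M.momentBound_averagedLaw n) (fun I b => ?_) fun t y I b hI => ?_⟩
  · refine Tendsto.mono_left ?_ hl
    have h1 : ∀ j, (M.startedPathLaw j).real (shift ⁻¹' cyl I b) =
        (M.startedPathLaw (j + 1)).real (cyl I b) := by
      intro j
      simp only [startedPathLaw, measureReal_def]
      rw [Measure.map_apply (measurable_embed j) (measurable_shift (measurableSet_cyl I b)),
        Measure.map_apply (measurable_embed _) (measurableSet_cyl I b), ← Set.preimage_comp]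
      congr 2
      ext z
      simp [shift_embed]
    have h2 : ∀ n, (M.averagedLaw n).real (shift ⁻¹' cyl I b) - (M.averagedLaw n).real (cyl I b) =
        ((n + 1 : ℕ) : ℝ)⁻¹ * ((M.startedPathLaw (n + 1)).real (cyl I b) -
          (M.startedPathLaw 0).real (cyl I b)) := by
      intro n
      rw [averagedLaw_real, averagedLaw_real, ← mul_sub, ← Finset.sum_sub_distrib]
      simp only [h1]
      rw [Finset.sum_range_sub fun j => (M.startedPathLaw j).real (cyl I b)]
    change Tendsto (fun n => (M.averagedLaw n).real (shift ⁻¹' cyl I b) -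
      (M.averagedLaw n).real (cyl I b)) atTop (𝓝 0)
    simp only [h2]
    refine squeeze_zero_norm (a := fun n : ℕ => 1 / ((n : ℝ) + 1)) (fun n => ?_)
      tendsto_one_div_add_atTop_nhds_zero_nat
    rw [norm_mul, norm_inv, Real.norm_natCast, one_div]
    push_cast
    refine mul_le_of_le_one_right (by positivity) ?_
    exact abs_sub_le_of_nonneg_of_le measureReal_nonneg measureReal_le_one measureReal_nonneg
      measureReal_le_one
  · refine Tendsto.mono_left ?_ hl
    change Tendsto (fun n => M.defect (M.averagedLaw n) t y (cyl I b)) atTop (𝓝 0)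
    simp only [M.defect_averagedLaw _ t y (measurableSet_cyl I b)]
    refine tendsto_average (tendsto_const_nhds.congr' ?_)
    filter_upwards [eventually_ge_atTop (1 - t).toNat] with j hj
    exact (M.defect_startedPathLaw (by omega) y I b hI).symm

end CountModel

end Existence
section Solutions

namespace CountModel

variable {m : ℕ} (M : CountModel m) {μ : Measure (ℤ → Fin m → ℕ)} {C : ENNReal}

lemma CylStationary.measurePreserving [IsProbabilityMeasure μ] (h : CylStationary μ) :
    MeasurePreserving shift μ μ := by
  refine ⟨measurable_shift, ?_⟩
  have := Measure.isProbabilityMeasure_map (μ := μ) measurable_shift.aemeasurable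
  refine ext_of_generate_finite _ pi_eq_generateFrom (isPiSystem_cylinders Set.univ) ?_ (by simp)
  rintro _ ⟨I, b, -, rfl⟩
  rw [Measure.map_apply measurable_shift (measurableSet_cyl I b)]
  exact (measureReal_eq_measureReal_iff).1 (h I b)

lemma measure_inter_eq_iff_defect [IsProbabilityMeasure μ] (hμ : MomentBound μ C) (hC : C ≠ ⊤)
    (t : ℤ) (y : Fin m → ℕ) (B : Set (ℤ → Fin m → ℕ)) :
    μ (B ∩ {x | x t = y}) = ∫⁻ x in B, ENNReal.ofReal (M.q (pathPast t x) y) ∂μ ↔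
      M.defect μ t y B = 0 := by
  have hint := (M.integrable_q hμ hC t y).integrableOn (s := B)
  have h1 : ∫ x in B, M.q (pathPast t x) y ∂μ =
      (∫⁻ x in B, ENNReal.ofReal (M.q (pathPast t x) y) ∂μ).toReal :=
    integral_eq_lintegral_of_nonneg_ae (.of_forall fun _ => M.q_nonneg _ _)
      hint.aestronglyMeasurable
  rw [defect, sub_eq_zero, h1, measureReal_def, ENNReal.toReal_eq_toReal_iff' (measure_ne_top _ _)]
  exact ((hasFiniteIntegral_iff_ofReal (.of_forall fun _ => M.q_nonneg _ _)).1
    hint.hasFiniteIntegral).ne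

lemma CylSolution.measure_inter_eq [IsProbabilityMeasure μ] (h : M.CylSolution μ)
    (hμ : MomentBound μ C) (hC : C ≠ ⊤) (t : ℤ) (y : Fin m → ℕ) {B : Set (ℤ → Fin m → ℕ)}
    (hB : MeasurableSet[pathFilt m (t - 1)] B) :
    μ (B ∩ {x | x t = y}) = ∫⁻ x in B, ENNReal.ofReal (M.q (pathPast t x) y) ∂μ := by
  have hcyl : ∀ I b, (∀ s ∈ I, s ≤ t - 1) → μ.restrict {x | x t = y} (cyl I b) =
      μ.withDensity (fun x => ENNReal.ofReal (M.q (pathPast t x) y)) (cyl I b) := by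
    intro I b hI
    rw [Measure.restrict_apply (measurableSet_cyl I b),
      withDensity_apply _ (measurableSet_cyl I b), M.measure_inter_eq_iff_defect hμ hC]
    exact h t y I b hI
  have key := ext_on_measurableSpace_of_generate_finite MeasurableSpace.pi
    (μ := μ.restrict {x | x t = y})
    (ν := μ.withDensity fun x => ENNReal.ofReal (M.q (pathPast t x) y)) _
    (by rintro _ ⟨I, b, hI, rfl⟩; exact hcyl I b hI) (pathFilt_le (m := m) (t - 1))
    (pathFilt_eq_generateFrom _) (isPiSystem_cylinders _)
    (by simpa [cyl] using hcyl ∅ 0 (by simp)) hB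
  rwa [Measure.restrict_apply (pathFilt_le _ _ hB), withDensity_apply _ (pathFilt_le _ _ hB)] at key

lemma CylSolution.defect_eq_zero [IsProbabilityMeasure μ] (h : M.CylSolution μ)
    (hμ : MomentBound μ C) (hC : C ≠ ⊤) (t : ℤ) (y : Fin m → ℕ) {B : Set (ℤ → Fin m → ℕ)}
    (hB : MeasurableSet[pathFilt m (t - 1)] B) : M.defect μ t y B = 0 :=
  (M.measure_inter_eq_iff_defect hμ hC t y B).1 (h.measure_inter_eq M hμ hC t y hB)

lemma CylSolution.setLIntegral_eval [IsProbabilityMeasure μ] (h : M.CylSolution μ)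
    (hμ : MomentBound μ C) (hC : C ≠ ⊤) (t : ℤ) (i : Fin m) {B : Set (ℤ → Fin m → ℕ)}
    (hB : MeasurableSet[pathFilt m (t - 1)] B) :
    ∫⁻ x in B, (x t i : ENNReal) ∂μ = ∫⁻ x in B, ENNReal.ofReal (M.f (pathPast t x) i) ∂μ := by
  have h1 : ∀ x : ℤ → Fin m → ℕ, (x t i : ENNReal) =
      ∑' y : Fin m → ℕ, {x : ℤ → Fin m → ℕ | x t = y}.indicator (fun _ => (y i : ENNReal)) x := by
    intro x
    rw [tsum_eq_single (x t) fun y hy => Set.indicator_of_notMem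
      (show x ∉ {x : ℤ → Fin m → ℕ | x t = y} from fun h => hy h.symm) _,
      Set.indicator_of_mem (show x ∈ {z : ℤ → Fin m → ℕ | z t = x t} from rfl)]
  have hms : ∀ y : Fin m → ℕ, MeasurableSet {x : ℤ → Fin m → ℕ | x t = y} := fun y =>
    (isClopen_eval_eq t y).isClosed.measurableSet
  have hqm : ∀ y : Fin m → ℕ, AEMeasurable (fun x => ENNReal.ofReal (M.q (pathPast t x) y))
      (μ.restrict B) := fun y =>
    (((M.aestronglyMeasurable_q hμ hC t y).mono (pathFilt_le _)).aemeasurable.ennreal_ofReal).restrict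
  simp only [h1, ← M.tsum_mul_ofReal_q]
  rw [lintegral_tsum fun y => (measurable_const.indicator (hms y)).aemeasurable,
    lintegral_tsum fun y => (hqm y).const_mul _]
  refine tsum_congr fun y => ?_
  rw [lintegral_indicator_const (hms y), Measure.restrict_apply (hms y), Set.inter_comm,
    h.measure_inter_eq M hμ hC t y hB, lintegral_const_mul'' _ (hqm y)]

lemma lintegral_size_eq_of_measurePreserving (h : MeasurePreserving shift μ μ) (t : ℤ) :
    ∫⁻ x, size (x t) ∂μ = ∫⁻ x, size (x 0) ∂μ := by
  have hstep : ∀ t : ℤ, ∫⁻ x, size (x (t + 1)) ∂μ = ∫⁻ x, size (x t) ∂μ := fun t =>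
    h.lintegral_comp (measurable_size_eval t)
  induction t using Int.induction_on with
  | zero => rfl
  | succ n ih => rw [hstep, ih]
  | pred n ih => rw [← ih, ← hstep]; simp

/-- The mean size of a stationary solution is bounded by a constant depending on the model only. -/
lemma momentBound_meanBound [IsProbabilityMeasure μ] (h : M.CylSolution μ)
    (hs : CylStationary μ) (hμ : MomentBound μ C) (hC : C ≠ ⊤) : MomentBound μ M.meanBound := by
  have hE := lintegral_size_eq_of_measurePreserving hs.measurePreserving
  set E := ∫⁻ x, size (x 0) ∂μ with hEdef
  have hEtop : E ≠ ⊤ := ne_top_of_le_ne_top hC (hμ 0)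
  have hμE : MomentBound μ E := fun t => (hE t).le
  have h1 : E ≤ ∑ i, ENNReal.ofReal (M.f 0 i) + M.coeffTail 0 * E := by
    calc E = ∑ i, ∫⁻ x, (x 0 i : ENNReal) ∂μ := by
          have hmeas : ∀ i : Fin m, Measurable fun x : ℤ → Fin m → ℕ => (x 0 i : ENNReal) :=
            fun i => (Measurable.of_discrete (f := fun y : Fin m → ℕ => (y i : ENNReal))).comp
              (measurable_pi_apply 0)
          exact lintegral_finsetSum _ fun i _ => hmeas i
      _ = ∑ i, ∫⁻ x, ENNReal.ofReal (M.f (pathPast 0 x) i) ∂μ := by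
          refine Finset.sum_congr rfl fun i _ => ?_
          simpa using h.setLIntegral_eval M hμ hC 0 i MeasurableSet.univ
      _ = ∫⁻ x, ∑ i, ENNReal.ofReal (M.f (pathPast 0 x) i) ∂μ :=
          (lintegral_finsetSum' _ fun i _ => ((M.aestronglyMeasurable_f hμ hC 0 i).mono
            (pathFilt_le _)).aemeasurable.ennreal_ofReal).symm
      _ ≤ ∫⁻ x, (∑ i, ENNReal.ofReal (M.f 0 i) + M.tail 0 (pathPast 0 x)) ∂μ :=
          lintegral_mono fun x => M.sum_f_le _
      _ ≤ _ := by
          rw [lintegral_add_left measurable_const, lintegral_const, measure_univ, mul_one]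
          exact add_le_add_right (M.lintegral_tail_le hμE 0 0) _
  intro t
  rw [hE t, meanBound, ENNReal.le_div_iff_mul_le
    (.inl (tsub_pos_of_lt M.coeffTail_zero_lt_one).ne')
    (.inl (ne_top_of_le_ne_top ENNReal.one_ne_top tsub_le_self)), mul_comm,
    ENNReal.sub_mul fun _ _ => hEtop, one_mul]
  exact tsub_le_iff_right.2 h1

/-- The inverse of the shift. -/
def unshift (x : ℤ → Fin m → ℕ) : ℤ → Fin m → ℕ := fun t => x (t - 1)

lemma shift_unshift (x : ℤ → Fin m → ℕ) : shift (unshift x) = x := by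
  funext t; simp [shift, unshift]

lemma unshift_shift (x : ℤ → Fin m → ℕ) : unshift (shift x) = x := by
  funext t; simp [shift, unshift]

lemma unshift_iterate (j : ℕ) (x : ℤ → Fin m → ℕ) (t : ℤ) : unshift^[j] x t = x (t - j) := by
  induction j generalizing x with
  | zero => simp
  | succ j ih => rw [Function.iterate_succ_apply, ih, unshift]; congr 1; push_cast; ring

lemma measurable_unshift : Measurable (unshift : (ℤ → Fin m → ℕ) → ℤ → Fin m → ℕ) :=
  measurable_pi_lambda _ fun t => measurable_pi_apply (t - 1)

lemma measurePreserving_unshift (h : MeasurePreserving shift μ μ) :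
    MeasurePreserving unshift μ μ := by
  refine ⟨measurable_unshift, ?_⟩
  conv_lhs => rw [← h.map_eq]
  rw [Measure.map_map measurable_unshift measurable_shift]
  simp [Function.comp_def, unshift_shift]

lemma measurable_unshift_iterate (j : ℕ) (n : ℤ) :
    Measurable[pathFilt m (n - j), pathFilt m n]
      (unshift^[j] : (ℤ → Fin m → ℕ) → ℤ → Fin m → ℕ) := by
  rw [measurable_iff_comap_le, pathFilt, filt, MeasurableSpace.comap_iSup]
  refine iSup_le fun s => ?_
  rw [MeasurableSpace.comap_comp, ← measurable_iff_comap_le]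
  have : (fun x : ℤ → Fin m → ℕ => x s.1) ∘ unshift^[j] = fun x => x (s.1 - j) := by
    funext x; exact unshift_iterate j x s.1
  rw [this]
  exact measurable_eval_pathFilt (by linarith [s.2])

lemma isSetRing_pathFilt :
    IsSetRing {B : Set (ℤ → Fin m → ℕ) | ∃ n, MeasurableSet[pathFilt m n] B} where
  empty_mem := ⟨0, @MeasurableSet.empty _ (pathFilt m 0)⟩
  union_mem := by
    rintro s t ⟨n, hs⟩ ⟨k, ht⟩
    exact ⟨max n k, (pathFilt_mono (le_max_left n k) _ hs).union
      (pathFilt_mono (le_max_right n k) _ ht)⟩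
  sdiff_mem := by
    rintro s t ⟨n, hs⟩ ⟨k, ht⟩
    exact ⟨max n k, (pathFilt_mono (le_max_left n k) _ hs).diff
      (pathFilt_mono (le_max_right n k) _ ht)⟩

lemma pi_eq_generateFrom_pathFilt : (MeasurableSpace.pi : MeasurableSpace (ℤ → Fin m → ℕ)) =
    MeasurableSpace.generateFrom {B | ∃ n, MeasurableSet[pathFilt m n] B} := by
  apply le_antisymm
  · refine iSup_le fun s => ?_
    intro B hB
    exact MeasurableSpace.measurableSet_generateFrom ⟨s, (le_iSup (fun r : {r : ℤ // r ≤ s} =>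
      MeasurableSpace.comap (fun x : ℤ → Fin m → ℕ => x r.1) inferInstance) ⟨s, le_rfl⟩) _ hB⟩
  · refine MeasurableSpace.generateFrom_le ?_
    rintro B ⟨n, hB⟩
    exact pathFilt_le n _ hB

/-- An invariant event is approximated by events of the arbitrarily remote past. -/
lemma exists_pathFilt_approx [IsProbabilityMeasure μ] (h : MeasurePreserving shift μ μ)
    {A : Set (ℤ → Fin m → ℕ)} (hA : MeasurableSet A) (hinv : shift ⁻¹' A = A) (t : ℤ)
    {ε : ENNReal} (hε : 0 < ε) :
    ∃ B, MeasurableSet[pathFilt m t] B ∧ μ (symmDiff B A) < ε := by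
  obtain ⟨B, ⟨n, hB⟩, hBA⟩ := exists_measure_symmDiff_lt_of_generateFrom_isSetRing (μ := μ)
    isSetRing_pathFilt ⟨{Set.univ}, Set.countable_singleton _,
      by rintro _ rfl; exact ⟨0, @MeasurableSet.univ _ (pathFilt m 0)⟩, by simp⟩ pi_eq_generateFrom_pathFilt hA hε
  have hinv' : unshift ⁻¹' A = A := by
    conv_lhs => rw [← hinv]
    ext x
    simp [shift_unshift]
  have hinvj : ∀ j : ℕ, unshift^[j] ⁻¹' A = A := fun j => by
    induction j with
    | zero => rfl
    | succ j ih => rw [Function.iterate_succ, Set.preimage_comp, ih, hinv']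
  let j := (n - t).toNat
  refine ⟨unshift^[j] ⁻¹' B, pathFilt_mono (by omega) _ (measurable_unshift_iterate j n hB), ?_⟩
  have h1 := ((measurePreserving_unshift h).iterate j).measure_preimage
    ((pathFilt_le _ _ hB).symmDiff hA).nullMeasurableSet
  rw [Set.preimage_symmDiff, hinvj] at h1
  rwa [h1]

lemma defect_eq_integral [IsProbabilityMeasure μ] (hμ : MomentBound μ C) (hC : C ≠ ⊤) (t : ℤ)
    (y : Fin m → ℕ) {B : Set (ℤ → Fin m → ℕ)} (hB : MeasurableSet B) :
    M.defect μ t y B = ∫ x, B.indicator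
      (fun x => {x : ℤ → Fin m → ℕ | x t = y}.indicator 1 x - M.q (pathPast t x) y) x ∂μ := by
  have hy := (isClopen_eval_eq t y).isClosed.measurableSet
  have h1 : Integrable ({x : ℤ → Fin m → ℕ | x t = y}.indicator
      (1 : (ℤ → Fin m → ℕ) → ℝ)) μ :=
    (integrable_const (1 : ℝ)).indicator hy
  rw [integral_indicator hB, integral_sub h1.integrableOn
    (M.integrable_q hμ hC t y).integrableOn, integral_indicator_one hy,
    measureReal_restrict_apply hy, Set.inter_comm]
  rfl

lemma abs_defect_sub_defect_le [IsProbabilityMeasure μ] (hμ : MomentBound μ C) (hC : C ≠ ⊤)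
    (t : ℤ) (y : Fin m → ℕ) {A B : Set (ℤ → Fin m → ℕ)} (hA : MeasurableSet A)
    (hB : MeasurableSet B) :
    |M.defect μ t y A - M.defect μ t y B| ≤ μ.real (symmDiff A B) := by
  have hy := (isClopen_eval_eq t y).isClosed.measurableSet
  let g : (ℤ → Fin m → ℕ) → ℝ :=
    fun x => {x : ℤ → Fin m → ℕ | x t = y}.indicator 1 x - M.q (pathPast t x) y
  have hg : Integrable g μ :=
    ((integrable_const (1 : ℝ)).indicator hy).sub (M.integrable_q hμ hC t y)
  have hg1 : ∀ x, |g x| ≤ 1 := by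
    intro x
    refine abs_sub_le_of_nonneg_of_le ?_ ?_ (M.q_nonneg _ _) (M.q_le_one _ _)
    · exact Set.indicator_nonneg (fun _ _ => zero_le_one) _
    · exact Set.indicator_le' (fun _ _ => le_rfl) (fun _ _ => zero_le_one) _
  rw [M.defect_eq_integral hμ hC t y hA, M.defect_eq_integral hμ hC t y hB,
    ← integral_sub (hg.indicator hA) (hg.indicator hB), ← integral_indicator_one (hA.symmDiff hB)]
  refine abs_integral_le_integral_abs.trans (integral_mono
    ((hg.indicator hA).sub (hg.indicator hB)).abs
    ((integrable_const (1 : ℝ)).indicator (hA.symmDiff hB)) fun x => ?_)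
  change |A.indicator g x - B.indicator g x| ≤ (symmDiff A B).indicator 1 x
  by_cases h1 : x ∈ A <;> by_cases h2 : x ∈ B <;>
    simp [h1, h2, Set.mem_symmDiff, hg1]

/-- The conditional distributions of a stationary solution do not change when we condition on an
invariant event. -/
lemma CylSolution.defect_inter_eq_zero [IsProbabilityMeasure μ] (h : M.CylSolution μ)
    (hs : MeasurePreserving shift μ μ) (hμ : MomentBound μ C) (hC : C ≠ ⊤)
    {A : Set (ℤ → Fin m → ℕ)} (hA : MeasurableSet A) (hinv : shift ⁻¹' A = A) {t : ℤ}
    (y : Fin m → ℕ) {B : Set (ℤ → Fin m → ℕ)} (hB : MeasurableSet[pathFilt m (t - 1)] B) :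
    M.defect μ t y (A ∩ B) = 0 := by
  refine abs_eq_zero.1 (le_antisymm (le_of_forall_pos_le_add fun ε hε => ?_) (abs_nonneg _))
  obtain ⟨A', hA', hlt⟩ := exists_pathFilt_approx hs hA hinv (t - 1) (ENNReal.ofReal_pos.2 hε)
  have hB' := pathFilt_le _ _ hB
  have hA'' := pathFilt_le _ _ hA'
  have h1 := M.abs_defect_sub_defect_le hμ hC t y (hA.inter hB') (hA''.inter hB')
  rw [h.defect_eq_zero M hμ hC t y (hA'.inter hB), sub_zero] at h1
  refine h1.trans ?_
  rw [zero_add]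
  refine le_trans (measureReal_mono (s₂ := symmDiff A' A) ?_) ?_
  · intro x hx
    simp only [Set.mem_symmDiff, Set.mem_inter_iff] at hx ⊢
    tauto
  · exact ENNReal.toReal_le_of_le_ofReal hε.le hlt.le

/-- Conditioning a stationary solution on an invariant event gives a stationary solution. -/
lemma cond_mem_solutions [IsProbabilityMeasure μ] (h : M.CylSolution μ)
    (hs : CylStationary μ) (hμ : MomentBound μ C) (hC : C ≠ ⊤) {A : Set (ℤ → Fin m → ℕ)}
    (hA : MeasurableSet A) (hinv : shift ⁻¹' A = A) (hpos : μ A ≠ 0) :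
    ⟨ProbabilityTheory.cond μ A, ProbabilityTheory.cond_isProbabilityMeasure hpos⟩ ∈
      M.solutions M.meanBound := by
  have hprob := ProbabilityTheory.cond_isProbabilityMeasure hpos
  have hp := hs.measurePreserving
  have hbound : MomentBound (ProbabilityTheory.cond μ A) ((μ A)⁻¹ * C) := by
    intro t
    rw [ProbabilityTheory.cond, lintegral_smul_measure, smul_eq_mul]
    exact mul_le_mul_right ((setLIntegral_le_lintegral _ _).trans (hμ t)) _
  have hstat : CylStationary (ProbabilityTheory.cond μ A) := by
    intro I b
    simp only [measureReal_def, ProbabilityTheory.cond_apply hA]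
    conv_lhs => rw [← hinv, ← Set.preimage_inter, hp.measure_preimage
      (hA.inter (measurableSet_cyl I b)).nullMeasurableSet, hinv]
  have hsol : M.CylSolution (ProbabilityTheory.cond μ A) := by
    intro t y I b hI
    have hcyl : MeasurableSet[pathFilt m (t - 1)] (cyl I b) := by
      rw [pathFilt_eq_generateFrom]
      exact MeasurableSpace.measurableSet_generateFrom ⟨I, b, hI, rfl⟩
    have h0 := h.defect_inter_eq_zero M hp hμ hC hA hinv y hcyl
    rw [defect, sub_eq_zero] at h0
    rw [defect, measureReal_def, ProbabilityTheory.cond_apply hA, ← Set.inter_assoc,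
      ENNReal.toReal_mul, ← measureReal_def μ, h0, ProbabilityTheory.cond, Measure.restrict_smul,
      integral_smul_measure, Measure.restrict_restrict (measurableSet_cyl I b),
      Set.inter_comm A, smul_eq_mul, sub_self]
  have hmom := M.momentBound_meanBound hsol hstat hbound
    (ENNReal.mul_ne_top (by simp [hpos]) hC)
  exact And.intro hmom (And.intro hstat hsol)

lemma exists_seq_cyl : ∃ e : ℕ → Set (ℤ → Fin m → ℕ),
    (∀ n, IsClopen (e n)) ∧ ∀ I b, ∃ n, e n = cyl I b := by
  let F : (Σ I : Finset ℤ, (I → Fin m → ℕ)) → Set (ℤ → Fin m → ℕ) :=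
    fun c => cyl c.1 fun s => if hs : s ∈ c.1 then c.2 ⟨s, hs⟩ else 0
  have : Nonempty (Σ I : Finset ℤ, (I → Fin m → ℕ)) := ⟨⟨∅, 0⟩⟩
  obtain ⟨u, hu⟩ := exists_surjective_nat (Σ I : Finset ℤ, (I → Fin m → ℕ))
  refine ⟨fun n => F (u n), fun n => isClopen_cyl _ _, fun I b => ?_⟩
  obtain ⟨n, hn⟩ := hu ⟨I, fun s => b s⟩
  refine ⟨n, ?_⟩
  simp only [hn, F]
  ext x
  refine forall₂_congr fun s hs => ?_
  simp [hs]

/-- The weighted sum of the squares of the probabilities of the events `e n`. -/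
def energy (e : ℕ → Set (ℤ → Fin m → ℕ)) (μ : Measure (ℤ → Fin m → ℕ)) : ℝ :=
  ∑' n, (1 / 2 : ℝ) ^ n * μ.real (e n) ^ 2

lemma norm_energy_term_le (e : ℕ → Set (ℤ → Fin m → ℕ)) (μ : Measure (ℤ → Fin m → ℕ))
    [IsProbabilityMeasure μ] (n : ℕ) :
    ‖(1 / 2 : ℝ) ^ n * μ.real (e n) ^ 2‖ ≤ (1 / 2 : ℝ) ^ n := by
  rw [Real.norm_of_nonneg (by positivity)]
  exact mul_le_of_le_one_right (by positivity) (pow_le_one₀ measureReal_nonneg measureReal_le_one)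

lemma hasSum_energy (e : ℕ → Set (ℤ → Fin m → ℕ)) (μ : Measure (ℤ → Fin m → ℕ))
    [IsProbabilityMeasure μ] :
    HasSum (fun n => (1 / 2 : ℝ) ^ n * μ.real (e n) ^ 2) (energy e μ) :=
  (Summable.of_norm_bounded summable_geometric_two (norm_energy_term_le e μ)).hasSum

lemma continuous_energy {e : ℕ → Set (ℤ → Fin m → ℕ)} (he : ∀ n, IsClopen (e n)) :
    Continuous fun μ : ProbabilityMeasure (ℤ → Fin m → ℕ) =>
      energy e (μ : Measure (ℤ → Fin m → ℕ)) :=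
  continuous_tsum (fun n => continuous_const.mul ((continuous_measureReal (he n)).pow 2))
    summable_geometric_two fun n _ => norm_energy_term_le e _ n

/-- Strict convexity of the energy along the splitting of a measure by conditioning. -/
lemma measureReal_eq_of_energy_le [IsProbabilityMeasure μ] {e : ℕ → Set (ℤ → Fin m → ℕ)}
    {A : Set (ℤ → Fin m → ℕ)} (hA : MeasurableSet A) (h0 : μ A ≠ 0) (h1 : μ Aᶜ ≠ 0)
    (hle : energy e (ProbabilityTheory.cond μ A) ≤ energy e μ)
    (hle' : energy e (ProbabilityTheory.cond μ Aᶜ) ≤ energy e μ) (n : ℕ) :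
    (ProbabilityTheory.cond μ A).real (e n) = (ProbabilityTheory.cond μ Aᶜ).real (e n) := by
  have hprob := ProbabilityTheory.cond_isProbabilityMeasure h0
  have hprob' := ProbabilityTheory.cond_isProbabilityMeasure h1
  set μ₁ := ProbabilityTheory.cond μ A with hμ₁
  set μ₂ := ProbabilityTheory.cond μ Aᶜ with hμ₂
  have hp : 0 < μ.real A := ENNReal.toReal_pos h0 (measure_ne_top _ _)
  have hp' : 0 < μ.real Aᶜ := ENNReal.toReal_pos h1 (measure_ne_top _ _)
  have hadd : μ.real A + μ.real Aᶜ = 1 := by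
    rw [measureReal_add_measureReal_compl hA]; simp
  have hsplit : ∀ S, μ.real S = μ.real A * μ₁.real S + μ.real Aᶜ * μ₂.real S := by
    intro S
    rw [hμ₁, hμ₂, measureReal_def (ProbabilityTheory.cond μ A),
      measureReal_def (ProbabilityTheory.cond μ Aᶜ), ProbabilityTheory.cond_apply hA,
      ProbabilityTheory.cond_apply hA.compl, ENNReal.toReal_mul, ENNReal.toReal_mul,
      ENNReal.toReal_inv, ENNReal.toReal_inv, ← measureReal_def, ← measureReal_def,
      ← measureReal_def, ← measureReal_def, mul_inv_cancel_left₀ hp.ne',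
      mul_inv_cancel_left₀ hp'.ne', Set.inter_comm, Set.inter_comm Aᶜ,
      ← Set.sdiff_eq, measureReal_inter_add_sdiff hA]
  have hsum := (((hasSum_energy e μ₁).mul_left (μ.real A)).add
    ((hasSum_energy e μ₂).mul_left (μ.real Aᶜ))).sub (hasSum_energy e μ)
  have hterm : ∀ n, μ.real A * ((1 / 2 : ℝ) ^ n * μ₁.real (e n) ^ 2) +
      μ.real Aᶜ * ((1 / 2 : ℝ) ^ n * μ₂.real (e n) ^ 2) - (1 / 2 : ℝ) ^ n * μ.real (e n) ^ 2 =
      (1 / 2 : ℝ) ^ n * (μ.real A * μ.real Aᶜ) * (μ₁.real (e n) - μ₂.real (e n)) ^ 2 := by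
    intro n
    rw [hsplit (e n), show μ.real Aᶜ = 1 - μ.real A by linarith]
    ring
  simp only [hterm] at hsum
  have hnonneg : ∀ n, 0 ≤ (1 / 2 : ℝ) ^ n * (μ.real A * μ.real Aᶜ) *
      (μ₁.real (e n) - μ₂.real (e n)) ^ 2 := fun n => by positivity
  have hn := le_hasSum hsum n fun k _ => hnonneg k
  have hle0 : μ.real A * energy e μ₁ + μ.real Aᶜ * energy e μ₂ - energy e μ ≤ 0 := by
    have : energy e μ = μ.real A * energy e μ + μ.real Aᶜ * energy e μ := by
      rw [← add_mul, hadd, one_mul]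
    nlinarith
  have hz := le_antisymm (hn.trans hle0) (hnonneg n)
  have hc : (1 / 2 : ℝ) ^ n * (μ.real A * μ.real Aᶜ) ≠ 0 := by positivity
  exact sub_eq_zero.1 (pow_eq_zero_iff two_ne_zero |>.1 ((mul_eq_zero.1 hz).resolve_left hc))

/-- A stationary solution of maximal energy is ergodic. -/
lemma ergodic_of_energy_max [IsProbabilityMeasure μ] (h : M.CylSolution μ)
    (hs : CylStationary μ) (hμ : MomentBound μ C) (hC : C ≠ ⊤)
    {e : ℕ → Set (ℤ → Fin m → ℕ)} (he : ∀ I b, ∃ n, e n = cyl I b)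
    (hmax : ∀ ν ∈ M.solutions M.meanBound, energy e (ν : Measure (ℤ → Fin m → ℕ)) ≤ energy e μ) :
    Ergodic shift μ := by
  refine ⟨hs.measurePreserving, ⟨fun A hA hinv => ?_⟩⟩
  rw [eventuallyConst_set]
  by_contra hcon
  rw [not_or] at hcon
  have h1 : μ Aᶜ ≠ 0 := hcon.1
  have h0 : μ A ≠ 0 := fun h => hcon.2 (measure_eq_zero_iff_ae_notMem.1 h)
  have hinv' : shift ⁻¹' Aᶜ = Aᶜ := by rw [Set.preimage_compl, hinv]
  have hA₁ := hmax _ (M.cond_mem_solutions h hs hμ hC hA hinv h0)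
  have hA₂ := hmax _ (M.cond_mem_solutions h hs hμ hC hA.compl hinv' h1)
  have hprob := ProbabilityTheory.cond_isProbabilityMeasure h0
  have hprob' := ProbabilityTheory.cond_isProbabilityMeasure h1
  have heq := measureReal_eq_of_energy_le hA h0 h1 hA₁ hA₂
  have hcond : ProbabilityTheory.cond μ A = ProbabilityTheory.cond μ Aᶜ := by
    refine ext_of_generate_finite _ pi_eq_generateFrom (isPiSystem_cylinders Set.univ) ?_ (by simp)
    rintro _ ⟨I, b, -, rfl⟩
    obtain ⟨n, hn⟩ := he I b
    rw [← hn]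
    exact (measureReal_eq_measureReal_iff).1 (heq n)
  have hAA := congrArg (fun ν => ν A) hcond
  simp only [ProbabilityTheory.cond_apply hA, ProbabilityTheory.cond_apply hA.compl,
    Set.inter_self, Set.compl_inter_self, measure_empty, mul_zero] at hAA
  rw [ENNReal.inv_mul_cancel h0 (measure_ne_top _ _)] at hAA
  exact one_ne_zero hAA

/-- There is an ergodic stationary solution. -/
theorem exists_ergodic_solution : ∃ μ : ProbabilityMeasure (ℤ → Fin m → ℕ),
    μ ∈ M.solutions M.meanBound ∧ Ergodic shift (μ : Measure (ℤ → Fin m → ℕ)) := by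
  obtain ⟨e, heC, he⟩ := exists_seq_cyl (m := m)
  obtain ⟨μ, hμ, hmax⟩ := (M.isCompact_solutions M.meanBound_ne_top).exists_isMaxOn
    M.solutions_nonempty (continuous_energy heC).continuousOn
  exact ⟨μ, hμ, M.ergodic_of_energy_max hμ.2.2 hμ.2.1 hμ.1 M.meanBound_ne_top he
    fun ν hν => hmax hν⟩

end CountModel

end Solutions
section Conditional

namespace CountModel

variable {m : ℕ} (M : CountModel m) {μ : Measure (ℤ → Fin m → ℕ)} {C : ENNReal}

lemma integrable_l1n_eval (hμ : MomentBound μ C) (hC : C ≠ ⊤) (t : ℤ) :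
    Integrable (fun x : ℤ → Fin m → ℕ => l1n (x t)) μ := by
  refine ⟨((Measurable.of_discrete (f := (l1n : (Fin m → ℕ) → ℝ))).comp
    (measurable_pi_apply t)).aestronglyMeasurable, ?_⟩
  have hnonneg : ∀ x : ℤ → Fin m → ℕ, 0 ≤ l1n (x t) := fun x =>
    Finset.sum_nonneg fun i _ => Nat.cast_nonneg _
  rw [hasFiniteIntegral_iff_ofReal (.of_forall hnonneg)]
  simp only [ofReal_l1n]
  exact (hμ t).trans_lt hC.lt_top

lemma integrable_eval (hμ : MomentBound μ C) (hC : C ≠ ⊤) (t : ℤ) (i : Fin m) :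
    Integrable (fun x : ℤ → Fin m → ℕ => (x t i : ℝ)) μ := by
  refine (integrable_l1n_eval hμ hC t).mono' ((Measurable.of_discrete
    (f := fun y : Fin m → ℕ => (y i : ℝ))).comp
    (measurable_pi_apply t)).aestronglyMeasurable (.of_forall fun x => ?_)
  rw [Real.norm_of_nonneg (Nat.cast_nonneg _)]
  exact Finset.single_le_sum (f := fun i => (x t i : ℝ)) (fun j _ => Nat.cast_nonneg _)
    (Finset.mem_univ i)

lemma CylSolution.condExp_indicator [IsProbabilityMeasure μ] (h : M.CylSolution μ)
    (hμ : MomentBound μ C) (hC : C ≠ ⊤) (t : ℤ) (y : Fin m → ℕ) :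
    μ[({x : ℤ → Fin m → ℕ | x t = y}.indicator fun _ => (1 : ℝ)) | pathFilt m (t - 1)] =ᵐ[μ]
      fun x => M.q (pathPast t x) y := by
  have hy := (isClopen_eval_eq t y).isClosed.measurableSet
  refine (ae_eq_condExp_of_forall_setIntegral_eq (pathFilt_le _)
    ((integrable_const (1 : ℝ)).indicator hy)
    (fun B _ _ => (M.integrable_q hμ hC t y).integrableOn) (fun B hB _ => ?_)
    (M.aestronglyMeasurable_q hμ hC t y)).symm
  have h0 := h.defect_eq_zero M hμ hC t y hB
  rw [defect, sub_eq_zero] at h0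
  rw [← h0]
  change _ = ∫ x in B, {x : ℤ → Fin m → ℕ | x t = y}.indicator 1 x ∂μ
  rw [integral_indicator_one hy, measureReal_restrict_apply hy, Set.inter_comm]

lemma CylSolution.condExp_eval [IsProbabilityMeasure μ] (h : M.CylSolution μ)
    (hμ : MomentBound μ C) (hC : C ≠ ⊤) (t : ℤ) (i : Fin m) :
    μ[(fun x : ℤ → Fin m → ℕ => (x t i : ℝ)) | pathFilt m (t - 1)] =ᵐ[μ]
      fun x => M.f (pathPast t x) i := by
  have hint := integrable_eval hμ hC t i
  have hmeas := (M.aestronglyMeasurable_f hμ hC t i).mono (pathFilt_le _)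
  have hset : ∀ B, MeasurableSet[pathFilt m (t - 1)] B →
      ∫⁻ x in B, ENNReal.ofReal (x t i : ℝ) ∂μ =
        ∫⁻ x in B, ENNReal.ofReal (M.f (pathPast t x) i) ∂μ := fun B hB => by
    simp only [ENNReal.ofReal_natCast]
    exact h.setLIntegral_eval M hμ hC t i hB
  have hf : Integrable (fun x => M.f (pathPast t x) i) μ := by
    refine ⟨hmeas, ?_⟩
    have h1 := hset Set.univ (@MeasurableSet.univ _ (pathFilt m (t - 1)))
    rw [setLIntegral_univ, setLIntegral_univ] at h1
    rw [hasFiniteIntegral_iff_ofReal (.of_forall fun x => M.f_nonneg _ _), ← h1]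
    exact (hasFiniteIntegral_iff_ofReal (.of_forall fun _ => Nat.cast_nonneg _)).1 hint.2
  refine (ae_eq_condExp_of_forall_setIntegral_eq (pathFilt_le _) hint
    (fun B _ _ => hf.integrableOn) (fun B hB _ => ?_)
    (M.aestronglyMeasurable_f hμ hC t i)).symm
  rw [integral_eq_lintegral_of_nonneg_ae (.of_forall fun _ => M.f_nonneg _ _) hmeas.restrict,
    integral_eq_lintegral_of_nonneg_ae (.of_forall fun _ => Nat.cast_nonneg _)
      hint.aestronglyMeasurable.restrict, hset B hB]

end CountModel

end Conditional

theorem exists_stationary_ergodic_solution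
    {m : ℕ}
    -- the m-parameter exponential family
    (A : (Fin m → ℝ) → ℝ) (h : (Fin m → ℕ) → ℝ) (hh : ∀ y, 0 ≤ h y)
    (N : Set (Fin m → ℝ))
    (hA : ContDiffOn ℝ 2 A N)
    -- p(·|η) is a probability distribution on ℕ₀^m for η ∈ N
    (hprob : ∀ η ∈ N, HasSum (fun y : Fin m → ℕ => expFam A h y η) 1)
    -- the mean of p(·|η) is ∂A(η)/∂η
    (hmean : ∀ η ∈ N, ∀ i,
      HasSum (fun y : Fin m → ℕ => (y i : ℝ) * expFam A h y η) (gradA A N η i))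
    -- the link function f = f_θ (θ fixed), with nonnegative components
    (f : (ℕ → Fin m → ℕ) → Fin m → ℝ) (hfpos : ∀ y i, 0 ≤ f y i)
    -- Assumption A₀(Θ) at θ: Lipschitz with ∑ α_k < 1 (‖f(0)‖ < ∞ is automatic)
    (α : ℕ → ℝ) (hαpos : ∀ k, 0 ≤ α k) (hαsum : Summable α) (hα1 : ∑' k, α k < 1)
    (hlip : ∀ y y' : ℕ → Fin m → ℕ,
      ENNReal.ofReal (l1 fun i => f y i - f y' i) ≤
        ∑' k, ENNReal.ofReal (α k * l1dist (y k) (y' k)))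
    -- every value of f lies in the range of η ↦ ∂A(η)/∂η
    (hrange : ∀ y, ∃ η ∈ N, ∀ i, gradA A N η i = f y i) :
    ∃ (Ω : Type) (_ : MeasurableSpace Ω) (μ : Measure Ω)
      (_ : IsProbabilityMeasure μ) (Y : ℤ → Ω → Fin m → ℕ),
      (∀ t, Measurable (Y t)) ∧
      -- strict stationarity and ergodicity: the shift preserves the law of the
      -- path and is ergodic for it
      Ergodic shift (μ.map fun ω (t : ℤ) => Y t ω) ∧
      -- E‖Y_t‖ < ∞
      (∀ t, Integrable (fun ω => l1n (Y t ω)) μ) ∧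
      -- the conditional distribution of Y_t given 𝓕_{t-1} is p(·|η_t) with
      -- ∂A(η_t)/∂η = f(Y_{t-1}, Y_{t-2}, …)
      (∀ t : ℤ, ∃ η : Ω → Fin m → ℝ,
        (∀ ω, η ω ∈ N ∧ ∀ i, gradA A N (η ω) i = f (past Y t ω) i) ∧
        ∀ y : Fin m → ℕ,
          μ[({ω | Y t ω = y}.indicator fun _ => (1 : ℝ)) | filt Y (t - 1)] =ᵐ[μ]
            fun ω => expFam A h y (η ω)) ∧
      -- in particular E(Y_t | 𝓕_{t-1}) = f(Y_{t-1}, Y_{t-2}, …)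
      (∀ t : ℤ, ∀ i,
        μ[(fun ω => (Y t ω i : ℝ)) | filt Y (t - 1)] =ᵐ[μ]
          fun ω => f (past Y t ω) i) := by
  choose η hηN hη using hrange
  have hη' : ∀ p, gradA A N (η p) = f p := fun p => funext (hη p)
  have hmean' : ∀ p i, HasSum (fun y : Fin m → ℕ => (y i : ℝ) * expFam A h y (η p)) (f p i) :=
    fun p i => hη p i ▸ hmean (η p) (hηN p) i
  let M : CountModel m :=
    { f := f
      q := fun p y => expFam A h y (η p)
      α := α
      q_nonneg := fun p y => mul_nonneg (Real.exp_nonneg _) (hh y)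
      hasSum_q := fun p => hprob _ (hηN p)
      hasSum_mean := hmean'
      tendsto_q := fun p y => tendsto_expFam hh (hprob _ (hηN p)) (hmean' p)
        (fun p' => hprob _ (hηN p')) hmean' tendsto_comap y
      α_nonneg := hαpos
      α_summable := hαsum
      α_lt_one := hα1
      lipschitz := hlip }
  obtain ⟨μ, ⟨hbound, -, hsol⟩, herg⟩ := M.exists_ergodic_solution
  refine ⟨ℤ → Fin m → ℕ, inferInstance, μ, inferInstance, fun t x => x t,
    fun t => measurable_pi_apply t, ?_,
    CountModel.integrable_l1n_eval hbound M.meanBound_ne_top,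
    fun t => ⟨fun x => η (pathPast t x), fun x => ⟨hηN _, hη _⟩, fun y =>
      hsol.condExp_indicator M hbound M.meanBound_ne_top t y⟩,
    fun t i => hsol.condExp_eval M hbound M.meanBound_ne_top t i⟩
  change Ergodic shift (Measure.map id (μ : Measure (ℤ → Fin m → ℕ)))
  rwa [Measure.map_id]

end ChangePointProp41
end
end
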